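/- arXiv:1712.01587 — 5 statements merged into one kernel-verified Lean document; each statement's English description precedes it below -/
import Mathlib

section
/- Let ω = ζ₃, S = diag(1,ω,ω²), and V = (1/(i·√3))·M where M is the matrix with rows (1,1,1), (1,ω,ω²), (1,ω²,ω); let E ≤ SL(3,ℂ) be the subgroup generated by S, M_τ, V (the group E₁₀₈). Then: (i) the E-orbit of [1:0:0] in ℙ² equals the six-element set {[1:0:0],[0:1:0],[0:0:1],[1:1:1],[1:ω:ω²],[1:ω²:ω]}; (ii) the E-orbit of [1:ω:ω] equals the six-element set {[1:ω:ω],[1:ω²:1],[1:1:ω²],[1:ω²:ω²],[1:1:ω],[1:ω:1]}; (iii) neither of these two six-point sets has three collinear points, and neither lies on a conic; (iv) every point of ℙ² not belonging to these two orbits has E-orbit with more than 8 elements. -/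
open Matrix Complex

noncomputable section

abbrev M3 : Type := Matrix (Fin 3) (Fin 3) ℂ
abbrev SL3 : Type := Matrix.SpecialLinearGroup (Fin 3) ℂ
abbrev P2 : Type := Projectivization ℂ (Fin 3 → ℂ)

/-- The matrix `M_τ`. -/
def Mtau : M3 := !![0,1,0; 0,0,1; 1,0,0]

/-- `ζ_n = exp(2πi/n)`. -/
def zeta (n : ℕ) : ℂ := Complex.exp (2 * Real.pi * Complex.I / n)

/-- The subgroup of `SL(3,ℂ)` generated by a given set of matrices. -/
def genSL (s : Set M3) : Subgroup SL3 :=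
  Subgroup.closure { g : SL3 | (g : M3) ∈ s }

/-- The orbit of a point of `ℙ²` under a set of (invertible) matrices,
acting by `[v] ↦ [g·v]`. -/
def projOrbit (G : Set M3) (p : P2) : Set P2 :=
  { q | ∃ g ∈ G, ∃ h : g.mulVec p.rep ≠ 0, Projectivization.mk ℂ (g.mulVec p.rep) h = q }

/-- The orbit of a point of `ℙ²` under a subgroup of `SL(3,ℂ)`. -/
def projOrbitSL (G : Subgroup SL3) (p : P2) : Set P2 :=
  projOrbit ((fun g : SL3 => (g : M3)) '' (G : Set SL3)) p

/-- The point `[x:y:z] ∈ ℙ²`. -/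
def pt (x y z : ℂ) (h : ![x,y,z] ≠ 0) : P2 := Projectivization.mk ℂ ![x,y,z] h

lemma vne₀ {x y z : ℂ} (hx : x ≠ 0) : ![x,y,z] ≠ 0 := by
  intro h; exact hx (by simpa using congrFun h 0)

lemma vne₁ {x y z : ℂ} (hy : y ≠ 0) : ![x,y,z] ≠ 0 := by
  intro h; exact hy (by simpa using congrFun h 1)

lemma vne₂ {x y z : ℂ} (hz : z ≠ 0) : ![x,y,z] ≠ 0 := by
  intro h; exact hz (by simpa using congrFun h 2)

/-- No three distinct points of `P` are collinear. -/
def NoThreeCollinear (P : Set P2) : Prop :=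
  ∀ p q r, p ∈ P → q ∈ P → r ∈ P → p ≠ q → p ≠ r → q ≠ r →
    LinearIndependent ℂ ![p.rep, q.rep, r.rep]

/-- The points of `P` all lie on a conic. -/
def LiesOnConic (P : Set P2) : Prop :=
  ∃ Q : QuadraticForm ℂ (Fin 3 → ℂ), Q ≠ 0 ∧ ∀ p ∈ P, Q p.rep = 0

/-- The matrix `S = diag(1, ω, ω²)`, `ω = ζ₃`. -/
def Smat : M3 := Matrix.diagonal ![1, zeta 3, zeta 3 ^ 2]

/-- The matrix `V = (1/(i√3))·M`, where `M` has rows `(1,1,1)`, `(1,ω,ω²)`, `(1,ω²,ω)`. -/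
def Vmat : M3 :=
  (Complex.I * (Real.sqrt 3 : ℂ))⁻¹ •
    !![1, 1, 1; 1, zeta 3, zeta 3 ^ 2; 1, zeta 3 ^ 2, zeta 3]

/-- The group `E₁₀₈ ≤ SL(3,ℂ)`, generated by `S`, `M_τ` and `V`. -/
def E108 : Subgroup SL3 := genSL {Smat, Mtau, Vmat}

/-- The first six-point set of STATEMENT 12. -/
def orb₁ : Set P2 :=
  {pt 1 0 0 (vne₀ one_ne_zero), pt 0 1 0 (vne₁ one_ne_zero), pt 0 0 1 (vne₂ one_ne_zero),
   pt 1 1 1 (vne₀ one_ne_zero), pt 1 (zeta 3) (zeta 3 ^ 2) (vne₀ one_ne_zero),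
   pt 1 (zeta 3 ^ 2) (zeta 3) (vne₀ one_ne_zero)}

/-- The second six-point set of STATEMENT 12. -/
def orb₂ : Set P2 :=
  {pt 1 (zeta 3) (zeta 3) (vne₀ one_ne_zero), pt 1 (zeta 3 ^ 2) 1 (vne₀ one_ne_zero),
   pt 1 1 (zeta 3 ^ 2) (vne₀ one_ne_zero), pt 1 (zeta 3 ^ 2) (zeta 3 ^ 2) (vne₀ one_ne_zero),
   pt 1 1 (zeta 3) (vne₀ one_ne_zero), pt 1 (zeta 3) 1 (vne₀ one_ne_zero)}

lemma zeta_three_primitive : IsPrimitiveRoot (zeta 3) 3 :=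
  Complex.isPrimitiveRoot_exp 3 three_ne_zero

lemma zeta_three_relation : zeta 3 ^ 2 + zeta 3 + 1 = 0 := by
  have h := zeta_three_primitive.geom_sum_eq_zero (by norm_num)
  simp only [Finset.sum_range_succ, Finset.sum_range_zero] at h
  linear_combination h

lemma I_mul_sqrt_three : Complex.I * (Real.sqrt 3 : ℂ) = 1 + 2 * zeta 3 := by
  have h : zeta 3 = Complex.exp ((2 * Real.pi / 3 : ℝ) * Complex.I) := by
    rw [zeta]; congr 1; push_cast; ring
  have hang : 2 * Real.pi / 3 = Real.pi - Real.pi / 3 := by ring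
  rw [h, Complex.exp_mul_I, ← Complex.ofReal_cos, ← Complex.ofReal_sin, hang,
    Real.cos_pi_sub, Real.sin_pi_sub, Real.cos_pi_div_three, Real.sin_pi_div_three]
  push_cast
  ring

lemma one_add_two_zeta_ne_zero : 1 + 2 * zeta 3 ≠ 0 := by
  have := zeta_three_relation
  grind

/-- `S` as an element of `SL(3,ℂ)`. -/
def sGen : SL3 := ⟨Smat, by
  have h := zeta_three_primitive.pow_eq_one
  simp only [Smat, Matrix.det_diagonal, Fin.prod_univ_three, Matrix.cons_val]
  linear_combination h⟩

/-- `M_τ` as an element of `SL(3,ℂ)`. -/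
def tGen : SL3 := ⟨Mtau, by simp [Mtau, Matrix.det_fin_three]⟩

/-- `V` as an element of `SL(3,ℂ)`. -/
def vGen : SL3 := ⟨Vmat, by
  have h := zeta_three_relation
  have h0 := one_add_two_zeta_ne_zero
  rw [Vmat, I_mul_sqrt_three, Matrix.det_smul, Matrix.det_fin_three]
  simp only [Fintype.card_fin, Matrix.of_apply, Matrix.cons_val', Matrix.cons_val]
  field_simp
  grind⟩

lemma E108_eq_closure : E108 = Subgroup.closure {sGen, tGen, vGen} := by
  unfold E108 genSL
  congr 1
  ext g
  constructor
  · rintro (h | h | h)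
    exacts [Or.inl (Subtype.ext h), Or.inr (Or.inl (Subtype.ext h)),
      Or.inr (Or.inr (Subtype.ext h))]
  · rintro (rfl | rfl | rfl)
    exacts [Or.inl rfl, Or.inr (Or.inl rfl), Or.inr (Or.inr rfl)]

lemma sGen_mem : sGen ∈ E108 := by
  rw [E108_eq_closure]; exact Subgroup.subset_closure (by simp)

lemma tGen_mem : tGen ∈ E108 := by
  rw [E108_eq_closure]; exact Subgroup.subset_closure (by simp)

lemma vGen_mem : vGen ∈ E108 := by
  rw [E108_eq_closure]; exact Subgroup.subset_closure (by simp)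

lemma projOrbitSL_eq (G : Subgroup SL3) (p : P2) : projOrbitSL G p = MulAction.orbit G p := by
  have key (g : SL3) : ∃ h : (g : M3).mulVec p.rep ≠ 0,
      Projectivization.mk ℂ ((g : M3).mulVec p.rep) h = g • p := by
    refine ⟨(smul_ne_zero_iff_ne g).mpr p.rep_nonzero, ?_⟩
    conv_rhs => rw [← p.mk_rep]
    rfl
  ext q
  constructor
  · rintro ⟨_, ⟨g, hg, rfl⟩, h, rfl⟩
    obtain ⟨_, h'⟩ := key g
    exact ⟨⟨g, hg⟩, h'.symm⟩
  · rintro ⟨⟨g, hg⟩, rfl⟩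
    obtain ⟨h, h'⟩ := key g
    exact ⟨_, ⟨g, hg, rfl⟩, h, h'⟩

lemma mem_projOrbitSL_self (G : Subgroup SL3) (p : P2) : p ∈ projOrbitSL G p := by
  rw [projOrbitSL_eq]; exact MulAction.mem_orbit_self p

lemma smul_mem_projOrbitSL {G : Subgroup SL3} {g : SL3} (hg : g ∈ G) {p q : P2}
    (hq : q ∈ projOrbitSL G p) : g • q ∈ projOrbitSL G p := by
  rw [projOrbitSL_eq] at *
  exact MulAction.mem_orbit_of_mem_orbit (⟨g, hg⟩ : G) hq

lemma mk_eq_mk_of_cross {v w : Fin 3 → ℂ} (hv : v ≠ 0) (hw : w ≠ 0)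
    (h : ∀ i j, v i * w j = v j * w i) :
    Projectivization.mk ℂ v hv = Projectivization.mk ℂ w hw := by
  obtain ⟨i, hi⟩ := Function.ne_iff.mp hw
  have hi : w i ≠ 0 := hi
  rw [Projectivization.mk_eq_mk_iff']
  refine ⟨v i / w i, funext fun j => ?_⟩
  have := h i j
  simp only [Pi.smul_apply, smul_eq_mul]
  field_simp
  linear_combination this

lemma pt_eq_pt {x y z x' y' z' : ℂ} {h : ![x, y, z] ≠ 0} {h' : ![x', y', z'] ≠ 0}
    (hxy : x * y' = y * x') (hxz : x * z' = z * x') (hyz : y * z' = z * y') :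
    pt x y z h = pt x' y' z' h' := by
  refine mk_eq_mk_of_cross h h' fun i j => ?_
  fin_cases i <;> fin_cases j <;> simp <;> grind

lemma sGen_smul_vec (v : Fin 3 → ℂ) :
    sGen • v = ![v 0, zeta 3 * v 1, zeta 3 ^ 2 * v 2] := by
  change Smat.mulVec v = _
  ext i
  fin_cases i <;> simp [Smat, Matrix.mulVec_diagonal]

lemma tGen_smul_vec (v : Fin 3 → ℂ) : tGen • v = ![v 1, v 2, v 0] := by
  change Mtau.mulVec v = _
  ext i
  fin_cases i <;> simp [Mtau, Matrix.mulVec, dotProduct, Fin.sum_univ_three]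

lemma vGen_smul_vec (v : Fin 3 → ℂ) :
    vGen • v = (1 + 2 * zeta 3)⁻¹ • ![v 0 + v 1 + v 2, v 0 + zeta 3 * v 1 + zeta 3 ^ 2 * v 2,
      v 0 + zeta 3 ^ 2 * v 1 + zeta 3 * v 2] := by
  change Vmat.mulVec v = _
  rw [Vmat, I_mul_sqrt_three, Matrix.smul_mulVec]
  congr 1
  ext i
  fin_cases i <;> simp [Matrix.mulVec, dotProduct, Fin.sum_univ_three]

lemma sGen_smul_pt {x y z x' y' z' : ℂ} {h : ![x, y, z] ≠ 0} {h' : ![x', y', z'] ≠ 0}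
    (hxy : x * y' = zeta 3 * y * x') (hxz : x * z' = zeta 3 ^ 2 * z * x')
    (hyz : y * z' = zeta 3 * z * y') :
    sGen • pt x y z h = pt x' y' z' h' := by
  rw [pt, Projectivization.smul_mk]
  refine mk_eq_mk_of_cross _ h' fun i j => ?_
  rw [sGen_smul_vec]
  fin_cases i <;> fin_cases j <;> simp <;> grind

lemma tGen_smul_pt {x y z x' y' z' : ℂ} {h : ![x, y, z] ≠ 0} {h' : ![x', y', z'] ≠ 0}
    (hxy : y * y' = z * x') (hxz : y * z' = x * x') (hyz : z * z' = x * y') :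
    tGen • pt x y z h = pt x' y' z' h' := by
  rw [pt, Projectivization.smul_mk]
  refine mk_eq_mk_of_cross _ h' fun i j => ?_
  rw [tGen_smul_vec]
  fin_cases i <;> fin_cases j <;> simp <;> grind

lemma vGen_smul_pt {x y z x' y' z' : ℂ} {h : ![x, y, z] ≠ 0} {h' : ![x', y', z'] ≠ 0}
    (hxy : (x + y + z) * y' = (x + zeta 3 * y + zeta 3 ^ 2 * z) * x')
    (hxz : (x + y + z) * z' = (x + zeta 3 ^ 2 * y + zeta 3 * z) * x')
    (hyz : (x + zeta 3 * y + zeta 3 ^ 2 * z) * z' = (x + zeta 3 ^ 2 * y + zeta 3 * z) * y') :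
    vGen • pt x y z h = pt x' y' z' h' := by
  rw [pt, Projectivization.smul_mk]
  refine mk_eq_mk_of_cross _ h' fun i j => ?_
  rw [vGen_smul_vec]
  fin_cases i <;> fin_cases j <;> simp [mul_assoc] <;> grind

open scoped Pointwise in
lemma projOrbitSL_E108_subset {s : Set P2} (hs : s.Finite) {p : P2} (hp : p ∈ s)
    (h : ∀ q ∈ s, sGen • q ∈ s ∧ tGen • q ∈ s ∧ vGen • q ∈ s) : projOrbitSL E108 p ⊆ s := by
  have hle : E108 ≤ MulAction.stabilizer SL3 s := by
    rw [E108_eq_closure, Subgroup.closure_le]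
    rintro g (rfl | rfl | rfl) <;>
      rw [SetLike.mem_coe, MulAction.mem_stabilizer_set_iff_smul_set_subset hs] <;>
      rintro _ ⟨q, hq, rfl⟩
    exacts [(h q hq).1, (h q hq).2.1, (h q hq).2.2]
  rw [projOrbitSL_eq]
  rintro _ ⟨⟨g, hg⟩, rfl⟩
  have := MulAction.mem_stabilizer_iff.mp (hle hg)
  rw [← this]
  exact Set.smul_mem_smul_set hp

lemma projOrbitSL_E108_eq_orb₁ :
    projOrbitSL E108 (pt 1 0 0 (vne₀ one_ne_zero)) = orb₁ := by
  have hz := zeta_three_relation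
  apply Set.Subset.antisymm
  · refine projOrbitSL_E108_subset (by simp [orb₁]) (by simp [orb₁]) ?_
    simp only [orb₁, Set.mem_insert_iff, Set.mem_singleton_iff, forall_eq_or_imp, forall_eq]
    refine ⟨⟨?_, ?_, ?_⟩, ⟨?_, ?_, ?_⟩, ⟨?_, ?_, ?_⟩, ⟨?_, ?_, ?_⟩, ⟨?_, ?_, ?_⟩, ?_, ?_, ?_⟩
    · left; apply sGen_smul_pt <;> grind
    · right; right; left; apply tGen_smul_pt <;> grind
    · right; right; right; left; apply vGen_smul_pt <;> grind
    · right; left; apply sGen_smul_pt <;> grind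
    · left; apply tGen_smul_pt <;> grind
    · right; right; right; right; left; apply vGen_smul_pt <;> grind
    · right; right; left; apply sGen_smul_pt <;> grind
    · right; left; apply tGen_smul_pt <;> grind
    · right; right; right; right; right; apply vGen_smul_pt <;> grind
    · right; right; right; right; left; apply sGen_smul_pt <;> grind
    · right; right; right; left; apply tGen_smul_pt <;> grind
    · left; apply vGen_smul_pt <;> grind
    · right; right; right; right; right; apply sGen_smul_pt <;> grind
    · right; right; right; right; left; apply tGen_smul_pt <;> grind
    · right; right; left; apply vGen_smul_pt <;> grind
    · right; right; right; left; apply sGen_smul_pt <;> grind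
    · right; right; right; right; right; apply tGen_smul_pt <;> grind
    · right; left; apply vGen_smul_pt <;> grind
  · have m0 := mem_projOrbitSL_self E108 (pt 1 0 0 (vne₀ one_ne_zero))
    have m2 := smul_mem_projOrbitSL tGen_mem m0
    rw [tGen_smul_pt (x' := 0) (y' := 0) (z' := 1) (h' := vne₂ one_ne_zero)
      (by grind) (by grind) (by grind)] at m2
    have m1 := smul_mem_projOrbitSL tGen_mem m2
    rw [tGen_smul_pt (x' := 0) (y' := 1) (z' := 0) (h' := vne₁ one_ne_zero)
      (by grind) (by grind) (by grind)] at m1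
    have m3 := smul_mem_projOrbitSL vGen_mem m0
    rw [vGen_smul_pt (x' := 1) (y' := 1) (z' := 1) (h' := vne₀ one_ne_zero)
      (by grind) (by grind) (by grind)] at m3
    have m4 := smul_mem_projOrbitSL sGen_mem m3
    rw [sGen_smul_pt (x' := 1) (y' := zeta 3) (z' := zeta 3 ^ 2) (h' := vne₀ one_ne_zero)
      (by grind) (by grind) (by grind)] at m4
    have m5 := smul_mem_projOrbitSL sGen_mem m4
    rw [sGen_smul_pt (x' := 1) (y' := zeta 3 ^ 2) (z' := zeta 3) (h' := vne₀ one_ne_zero)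
      (by grind) (by grind) (by grind)] at m5
    rintro q (rfl | rfl | rfl | rfl | rfl | rfl) <;> assumption

lemma projOrbitSL_E108_eq_orb₂ :
    projOrbitSL E108 (pt 1 (zeta 3) (zeta 3) (vne₀ one_ne_zero)) = orb₂ := by
  have hz := zeta_three_relation
  apply Set.Subset.antisymm
  · refine projOrbitSL_E108_subset (by simp [orb₂]) (by simp [orb₂]) ?_
    simp only [orb₂, Set.mem_insert_iff, Set.mem_singleton_iff, forall_eq_or_imp, forall_eq]
    refine ⟨⟨?_, ?_, ?_⟩, ⟨?_, ?_, ?_⟩, ⟨?_, ?_, ?_⟩, ⟨?_, ?_, ?_⟩, ⟨?_, ?_, ?_⟩, ?_, ?_, ?_⟩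
    · right; left; apply sGen_smul_pt <;> grind
    · right; right; left; apply tGen_smul_pt <;> grind
    · right; right; right; left; apply vGen_smul_pt <;> grind
    · right; right; left; apply sGen_smul_pt <;> grind
    · left; apply tGen_smul_pt <;> grind
    · right; right; right; right; left; apply vGen_smul_pt <;> grind
    · left; apply sGen_smul_pt <;> grind
    · right; left; apply tGen_smul_pt <;> grind
    · right; right; right; right; right; apply vGen_smul_pt <;> grind
    · right; right; right; right; left; apply sGen_smul_pt <;> grind
    · right; right; right; right; left; apply tGen_smul_pt <;> grind
    · left; apply vGen_smul_pt <;> grind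
    · right; right; right; right; right; apply sGen_smul_pt <;> grind
    · right; right; right; right; right; apply tGen_smul_pt <;> grind
    · right; right; left; apply vGen_smul_pt <;> grind
    · right; right; right; left; apply sGen_smul_pt <;> grind
    · right; right; right; left; apply tGen_smul_pt <;> grind
    · right; left; apply vGen_smul_pt <;> grind
  · have m0 := mem_projOrbitSL_self E108 (pt 1 (zeta 3) (zeta 3) (vne₀ one_ne_zero))
    have m2 := smul_mem_projOrbitSL tGen_mem m0
    rw [tGen_smul_pt (x' := 1) (y' := 1) (z' := zeta 3 ^ 2) (h' := vne₀ one_ne_zero)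
      (by grind) (by grind) (by grind)] at m2
    have m1 := smul_mem_projOrbitSL tGen_mem m2
    rw [tGen_smul_pt (x' := 1) (y' := zeta 3 ^ 2) (z' := 1) (h' := vne₀ one_ne_zero)
      (by grind) (by grind) (by grind)] at m1
    have m3 := smul_mem_projOrbitSL vGen_mem m0
    rw [vGen_smul_pt (x' := 1) (y' := zeta 3 ^ 2) (z' := zeta 3 ^ 2) (h' := vne₀ one_ne_zero)
      (by grind) (by grind) (by grind)] at m3
    have m4 := smul_mem_projOrbitSL tGen_mem m3
    rw [tGen_smul_pt (x' := 1) (y' := 1) (z' := zeta 3) (h' := vne₀ one_ne_zero)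
      (by grind) (by grind) (by grind)] at m4
    have m5 := smul_mem_projOrbitSL tGen_mem m4
    rw [tGen_smul_pt (x' := 1) (y' := zeta 3) (z' := 1) (h' := vne₀ one_ne_zero)
      (by grind) (by grind) (by grind)] at m5
    rintro q (rfl | rfl | rfl | rfl | rfl | rfl) <;> assumption

lemma exists_smul_eq_rep {v : Fin 3 → ℂ} (hv : v ≠ 0) :
    ∃ a : ℂ, a ≠ 0 ∧ (Projectivization.mk ℂ v hv).rep = a • v := by
  obtain ⟨a, ha⟩ := Projectivization.exists_smul_eq_mk_rep ℂ v hv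
  exact ⟨a, a.ne_zero, ha.symm⟩

lemma linearIndependent_rep_mk {u v w : Fin 3 → ℂ} (hu : u ≠ 0) (hv : v ≠ 0) (hw : w ≠ 0)
    (h : (Matrix.of ![u, v, w]).det ≠ 0) :
    LinearIndependent ℂ ![(Projectivization.mk ℂ u hu).rep, (Projectivization.mk ℂ v hv).rep,
      (Projectivization.mk ℂ w hw).rep] := by
  obtain ⟨a, ha, hau⟩ := exists_smul_eq_rep hu
  obtain ⟨b, hb, hbv⟩ := exists_smul_eq_rep hv
  obtain ⟨c, hc, hcw⟩ := exists_smul_eq_rep hw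
  rw [hau, hbv, hcw]
  refine Matrix.linearIndependent_rows_of_det_ne_zero (A := Matrix.of ![a • u, b • v, c • w]) ?_
  have : (Matrix.of ![a • u, b • v, c • w]).det = a * b * c * (Matrix.of ![u, v, w]).det := by
    simp [Matrix.det_fin_three]
    ring
  rw [this]
  exact mul_ne_zero (mul_ne_zero (mul_ne_zero ha hb) hc) h

lemma det_ne_zero_of_distinct {v : Fin 6 → Fin 3 → ℂ}
    (hdet : ∀ i j k, i < j → j < k → (Matrix.of ![v i, v j, v k]).det ≠ 0) {i j k : Fin 6}
    (hij : i ≠ j) (hik : i ≠ k) (hjk : j ≠ k) : (Matrix.of ![v i, v j, v k]).det ≠ 0 := by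
  have swap₁ (a b c : Fin 3 → ℂ) :
      (Matrix.of ![a, b, c]).det = -(Matrix.of ![b, a, c]).det := by
    simp [Matrix.det_fin_three]; ring
  have swap₂ (a b c : Fin 3 → ℂ) :
      (Matrix.of ![a, b, c]).det = -(Matrix.of ![a, c, b]).det := by
    simp [Matrix.det_fin_three]; ring
  grind

lemma noThreeCollinear_range {v : Fin 6 → Fin 3 → ℂ} (hv : ∀ i, v i ≠ 0)
    (hdet : ∀ i j k, i < j → j < k → (Matrix.of ![v i, v j, v k]).det ≠ 0) :
    NoThreeCollinear (Set.range fun i => Projectivization.mk ℂ (v i) (hv i)) := by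
  rintro _ _ _ ⟨i, rfl⟩ ⟨j, rfl⟩ ⟨k, rfl⟩ hij hik hjk
  exact linearIndependent_rep_mk _ _ _ (det_ne_zero_of_distinct hdet
    (fun h => hij (by rw [h])) (fun h => hik (by rw [h])) (fun h => hjk (by rw [h])))

lemma encard_range_eq_six {v : Fin 6 → Fin 3 → ℂ} (hv : ∀ i, v i ≠ 0)
    (hdet : ∀ i j k, i < j → j < k → (Matrix.of ![v i, v j, v k]).det ≠ 0) :
    (Set.range fun i => Projectivization.mk ℂ (v i) (hv i)).encard = 6 := by
  have hinj : Function.Injective fun i => Projectivization.mk ℂ (v i) (hv i) := by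
    intro i j h
    by_contra hij
    obtain ⟨a, ha⟩ := (Projectivization.mk_eq_mk_iff' ℂ _ _ (hv i) (hv j)).mp h
    obtain ⟨k, hik, hjk⟩ : ∃ k, i ≠ k ∧ j ≠ k :=
      (by decide : ∀ i j : Fin 6, ∃ k, i ≠ k ∧ j ≠ k) i j
    refine det_ne_zero_of_distinct hdet hij hik hjk ?_
    rw [← ha]
    simp [Matrix.det_fin_three]
    ring
  rw [← Set.image_univ, hinj.encard_image, Set.encard_univ]
  simp

/-- Coordinate vectors of the points of `orb₁`. -/
def vecs₁ : Fin 6 → Fin 3 → ℂ :=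
  ![![1, 0, 0], ![0, 1, 0], ![0, 0, 1], ![1, 1, 1], ![1, zeta 3, zeta 3 ^ 2],
    ![1, zeta 3 ^ 2, zeta 3]]

/-- Coordinate vectors of the points of `orb₂`. -/
def vecs₂ : Fin 6 → Fin 3 → ℂ :=
  ![![1, zeta 3, zeta 3], ![1, zeta 3 ^ 2, 1], ![1, 1, zeta 3 ^ 2], ![1, zeta 3 ^ 2, zeta 3 ^ 2],
    ![1, 1, zeta 3], ![1, zeta 3, 1]]

lemma vecs₁_ne_zero (i : Fin 6) : vecs₁ i ≠ 0 := by
  fin_cases i <;> simp [vecs₁]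

lemma vecs₂_ne_zero (i : Fin 6) : vecs₂ i ≠ 0 := by
  fin_cases i <;> simp [vecs₂]

lemma orb₁_eq_range :
    orb₁ = Set.range fun i => Projectivization.mk ℂ (vecs₁ i) (vecs₁_ne_zero i) := by
  ext p
  simp [orb₁, pt, vecs₁, Fin.exists_fin_succ, eq_comm]

lemma orb₂_eq_range :
    orb₂ = Set.range fun i => Projectivization.mk ℂ (vecs₂ i) (vecs₂_ne_zero i) := by
  ext p
  simp [orb₂, pt, vecs₂, Fin.exists_fin_succ, eq_comm]

lemma det_vecs₁_ne_zero (i j k : Fin 6) (hij : i < j) (hjk : j < k) :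
    (Matrix.of ![vecs₁ i, vecs₁ j, vecs₁ k]).det ≠ 0 := by
  have hz := zeta_three_relation
  fin_cases i <;> fin_cases j <;> first | exact absurd hij (by decide) | skip
  all_goals fin_cases k <;> first | exact absurd hjk (by decide) | skip
  all_goals
    simp only [vecs₁, Matrix.det_fin_three, Matrix.of_apply, Matrix.cons_val, Fin.reduceFinMk,
      Fin.mk_zero, Fin.mk_one, Fin.isValue]
    grind

lemma det_vecs₂_ne_zero (i j k : Fin 6) (hij : i < j) (hjk : j < k) :
    (Matrix.of ![vecs₂ i, vecs₂ j, vecs₂ k]).det ≠ 0 := by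
  have hz := zeta_three_relation
  fin_cases i <;> fin_cases j <;> first | exact absurd hij (by decide) | skip
  all_goals fin_cases k <;> first | exact absurd hjk (by decide) | skip
  all_goals
    simp only [vecs₂, Matrix.det_fin_three, Matrix.of_apply, Matrix.cons_val, Fin.reduceFinMk,
      Fin.mk_zero, Fin.mk_one, Fin.isValue]
    grind

lemma quadraticForm_fin_three (Q : QuadraticForm ℂ (Fin 3 → ℂ)) :
    ∃ a b c d e f : ℂ, ∀ v, Q v = a * v 0 ^ 2 + b * v 1 ^ 2 + c * v 2 ^ 2 +
      d * (v 0 * v 1) + e * (v 0 * v 2) + f * (v 1 * v 2) := by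
  refine ⟨Q ![1, 0, 0], Q ![0, 1, 0], Q ![0, 0, 1], QuadraticMap.polar Q ![1, 0, 0] ![0, 1, 0],
    QuadraticMap.polar Q ![1, 0, 0] ![0, 0, 1], QuadraticMap.polar Q ![0, 1, 0] ![0, 0, 1],
    fun v => ?_⟩
  have hv : v = v 0 • ![1, 0, 0] + v 1 • ![0, 1, 0] + v 2 • ![0, 0, 1] := by
    ext i; fin_cases i <;> simp
  conv_lhs => rw [hv]
  rw [QuadraticMap.map_add Q, QuadraticMap.map_add Q, QuadraticMap.polar_add_left]
  simp only [QuadraticMap.map_smul, QuadraticMap.polar_smul_left, QuadraticMap.polar_smul_right,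
    smul_eq_mul]
  ring

lemma quadraticForm_mk_eq_zero {Q : QuadraticForm ℂ (Fin 3 → ℂ)} {v : Fin 3 → ℂ} {hv : v ≠ 0}
    (h : Q (Projectivization.mk ℂ v hv).rep = 0) : Q v = 0 := by
  obtain ⟨a, ha, hav⟩ := exists_smul_eq_rep hv
  rw [hav, QuadraticMap.map_smul, smul_eq_mul] at h
  exact (mul_eq_zero.mp h).resolve_left (mul_ne_zero ha ha)

lemma not_liesOnConic_orb₁ : ¬ LiesOnConic orb₁ := by
  rintro ⟨Q, hQ, h⟩
  apply hQ
  have hz := zeta_three_relation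
  have h' (i : Fin 6) : Q (vecs₁ i) = 0 :=
    quadraticForm_mk_eq_zero (h _ (orb₁_eq_range ▸ Set.mem_range_self i))
  obtain ⟨a, b, c, d, e, f, hform⟩ := quadraticForm_fin_three Q
  simp only [Fin.forall_fin_succ, hform, vecs₁] at h'
  simp at h'
  obtain ⟨rfl, rfl, rfl, h3, h4, h5⟩ := h'
  have hd : d = 0 := by grind
  have he : e = 0 := by grind
  have hf : f = 0 := by grind
  ext v
  simp [hform, hd, he, hf]

lemma not_liesOnConic_orb₂ : ¬ LiesOnConic orb₂ := by
  rintro ⟨Q, hQ, h⟩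
  apply hQ
  have hz := zeta_three_relation
  have h' (i : Fin 6) : Q (vecs₂ i) = 0 :=
    quadraticForm_mk_eq_zero (h _ (orb₂_eq_range ▸ Set.mem_range_self i))
  obtain ⟨a, b, c, d, e, f, hform⟩ := quadraticForm_fin_three Q
  simp only [Fin.forall_fin_succ, hform, vecs₂] at h'
  simp at h'
  obtain ⟨h0, h1, h2, h3, h4, h5⟩ := h'
  have ha : a = 0 := by grind
  have hb : b = 0 := by grind
  have hc : c = 0 := by grind
  have hd : d = 0 := by grind
  have he : e = 0 := by grind
  have hf : f = 0 := by grind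
  ext v
  simp [hform, ha, hb, hc, hd, he, hf]

lemma mem_orb_union_of_coord_eq_zero {v : Fin 3 → ℂ} (hv : v ≠ 0)
    (h : (v 1 = 0 ∧ v 2 = 0) ∨ (v 0 = 0 ∧ v 2 = 0) ∨ (v 0 = 0 ∧ v 1 = 0)) :
    Projectivization.mk ℂ v hv ∈ orb₁ ∪ orb₂ := by
  left
  rw [orb₁_eq_range]
  rcases h with ⟨h, h'⟩ | ⟨h, h'⟩ | ⟨h, h'⟩
  · refine ⟨0, mk_eq_mk_of_cross _ _ fun i j => ?_⟩
    fin_cases i <;> fin_cases j <;> simp [vecs₁, h, h']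
  · refine ⟨1, mk_eq_mk_of_cross _ _ fun i j => ?_⟩
    fin_cases i <;> fin_cases j <;> simp [vecs₁, h, h']
  · refine ⟨2, mk_eq_mk_of_cross _ _ fun i j => ?_⟩
    fin_cases i <;> fin_cases j <;> simp [vecs₁, h, h']

lemma eq_or_eq_of_pow_three_eq {x y : ℂ} (h : y ^ 3 = x ^ 3) :
    y = x ∨ y = zeta 3 * x ∨ y = zeta 3 ^ 2 * x := by
  have hz := zeta_three_relation
  have : (y - x) * ((y - zeta 3 * x) * (y - zeta 3 ^ 2 * x)) = 0 := by grind
  rcases mul_eq_zero.mp this with h | h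
  · exact Or.inl (sub_eq_zero.mp h)
  · exact Or.inr ((mul_eq_zero.mp h).imp sub_eq_zero.mp sub_eq_zero.mp)

lemma mem_orb_union_of_pow_three_eq {v : Fin 3 → ℂ} (hv : v ≠ 0)
    (h₁ : v 1 ^ 3 = v 0 ^ 3) (h₂ : v 2 ^ 3 = v 0 ^ 3) :
    Projectivization.mk ℂ v hv ∈ orb₁ ∪ orb₂ := by
  have hz := zeta_three_relation
  have of_vecs₁ (i : Fin 6) (h : ∀ j k, v j * vecs₁ i k = v k * vecs₁ i j) :
      Projectivization.mk ℂ v hv ∈ orb₁ ∪ orb₂ := by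
    left; rw [orb₁_eq_range]; exact ⟨i, (mk_eq_mk_of_cross _ _ h).symm⟩
  have of_vecs₂ (i : Fin 6) (h : ∀ j k, v j * vecs₂ i k = v k * vecs₂ i j) :
      Projectivization.mk ℂ v hv ∈ orb₁ ∪ orb₂ := by
    right; rw [orb₂_eq_range]; exact ⟨i, (mk_eq_mk_of_cross _ _ h).symm⟩
  rcases eq_or_eq_of_pow_three_eq h₁ with h₁ | h₁ | h₁ <;>
    rcases eq_or_eq_of_pow_three_eq h₂ with h₂ | h₂ | h₂
  on_goal 1 => apply of_vecs₁ 3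
  on_goal 2 => apply of_vecs₂ 4
  on_goal 3 => apply of_vecs₂ 2
  on_goal 4 => apply of_vecs₂ 5
  on_goal 5 => apply of_vecs₂ 0
  on_goal 6 => apply of_vecs₁ 4
  on_goal 7 => apply of_vecs₂ 1
  on_goal 8 => apply of_vecs₁ 5
  on_goal 9 => apply of_vecs₂ 3
  all_goals
    intro j k
    fin_cases j <;> fin_cases k <;> simp [vecs₁, vecs₂, h₁, h₂] <;> grind

lemma pow_three_eq_of_cyclic {x x' p q r a b : ℂ} (hx : x ^ 3 = 1) (hx' : x' ^ 3 = 1)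
    (ha : a ≠ 0) (hb : b ≠ 0) (h₀ : b * p = a * q) (h₁ : b * (x * q) = a * (x' * r))
    (h₂ : b * (x ^ 2 * r) = a * (x' ^ 2 * p)) : q ^ 3 = p ^ 3 ∧ r ^ 3 = p ^ 3 := by
  have hx0 : x ≠ 0 := by rintro rfl; simp at hx
  have hx0' : x' ≠ 0 := by rintro rfl; simp at hx'
  by_cases hp : p = 0
  · subst hp
    have hq : q = 0 := by simpa [ha] using h₀.symm
    subst hq
    have hr : r = 0 := by simpa [ha, hx0'] using h₁.symm
    simp [hr]
  have hq : q ≠ 0 := by rintro rfl; simp_all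
  have hr : r ≠ 0 := by rintro rfl; simp_all
  have hab : b ^ 3 = a ^ 3 := by
    have : b ^ 3 * (p * q * r) = a ^ 3 * (p * q * r) := by
      calc b ^ 3 * (p * q * r) = (b * p) * (b * (x * q)) * (b * (x ^ 2 * r)) := by
            linear_combination -b ^ 3 * (p * q * r) * hx
        _ = (a * q) * (a * (x' * r)) * (a * (x' ^ 2 * p)) := by rw [h₀, h₁, h₂]
        _ = a ^ 3 * (p * q * r) := by linear_combination a ^ 3 * (p * q * r) * hx'
    exact mul_right_cancel₀ (mul_ne_zero (mul_ne_zero hp hq) hr) this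
  have e₀ := congrArg (· ^ 3) h₀
  have e₁ := congrArg (· ^ 3) h₁
  simp only [mul_pow, hx, hx', hab, one_mul] at e₀ e₁
  have e₀ := mul_left_cancel₀ (pow_ne_zero 3 ha) e₀
  have e₁ := mul_left_cancel₀ (pow_ne_zero 3 ha) e₁
  exact ⟨e₀.symm, (e₀.trans e₁).symm⟩

lemma root_eq_of_diagonal {x x' p q r a : ℂ} (hx : x ^ 3 = 1) (hx' : x' ^ 3 = 1) (ha : a ≠ 0)
    (h₀ : p = a * p) (h₁ : x * q = a * (x' * q)) (h₂ : x ^ 2 * r = a * (x' ^ 2 * r))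
    (hqr : ¬ (q = 0 ∧ r = 0)) (hpr : ¬ (p = 0 ∧ r = 0)) (hpq : ¬ (p = 0 ∧ q = 0)) : x = x' := by
  have hx0 : x ≠ 0 := by rintro rfl; simp at hx
  have hx0' : x' ≠ 0 := by rintro rfl; simp at hx'
  grind

lemma sGen_pow_smul_vec (n : ℕ) (v : Fin 3 → ℂ) :
    sGen ^ n • v = ![v 0, zeta 3 ^ n * v 1, (zeta 3 ^ n) ^ 2 * v 2] := by
  induction n with
  | zero => ext i; fin_cases i <;> simp
  | succ n ih =>
    rw [pow_succ', mul_smul, ih, sGen_smul_vec]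
    ext i
    fin_cases i <;> simp <;> ring

lemma tGen_pow_smul_vec (j : Fin 3) (v : Fin 3 → ℂ) :
    tGen ^ (j : ℕ) • v = ![v j, v (j + 1), v (j + 2)] := by
  ext i
  fin_cases j <;> fin_cases i <;> simp [pow_two, mul_smul, tGen_smul_vec]

lemma heisenberg_injective {X : P2} (hX : X ∉ orb₁ ∪ orb₂) :
    Function.Injective fun ij : Fin 3 × Fin 3 =>
      (sGen ^ (ij.1 : ℕ) * tGen ^ (ij.2 : ℕ)) • X := by
  induction X using Projectivization.ind with | h v hv => ?_
  have hcoord := fun h => hX (mem_orb_union_of_coord_eq_zero hv h)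
  have hcube : ¬ (v 1 ^ 3 = v 0 ^ 3 ∧ v 2 ^ 3 = v 0 ^ 3) :=
    fun h => hX (mem_orb_union_of_pow_three_eq hv h.1 h.2)
  rintro ⟨i, j⟩ ⟨i', j'⟩ h
  have hpow (n : ℕ) : (zeta 3 ^ n) ^ 3 = 1 := by
    rw [← pow_mul, mul_comm, pow_mul, zeta_three_primitive.pow_eq_one, one_pow]
  simp only [Projectivization.smul_mk, mul_smul, sGen_pow_smul_vec, tGen_pow_smul_vec] at h
  obtain ⟨a, h⟩ := (Projectivization.mk_eq_mk_iff ℂ _ _ _ _).mp h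
  have e₀ : v j = a * v j' := by simpa [Units.smul_def] using (congrFun h 0).symm
  have e₁ : zeta 3 ^ (i : ℕ) * v (j + 1) = a * (zeta 3 ^ (i' : ℕ) * v (j' + 1)) := by
    simpa [Units.smul_def] using (congrFun h 1).symm
  have e₂ : (zeta 3 ^ (i : ℕ)) ^ 2 * v (j + 2) = a * ((zeta 3 ^ (i' : ℕ)) ^ 2 * v (j' + 2)) := by
    simpa [Units.smul_def] using (congrFun h 2).symm
  obtain rfl | rfl | rfl : j' = j ∨ j' = j + 1 ∨ j = j' + 1 :=
    (by decide : ∀ j j' : Fin 3, j' = j ∨ j' = j + 1 ∨ j = j' + 1) j j'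
  · have hij : zeta 3 ^ (i : ℕ) = zeta 3 ^ (i' : ℕ) := by
      apply root_eq_of_diagonal (hpow _) (hpow _) a.ne_zero e₀ e₁ e₂ <;>
        fin_cases j' <;> simp <;> tauto
    rw [Fin.ext (zeta_three_primitive.pow_inj i.2 i'.2 hij)]
  · refine absurd (pow_three_eq_of_cyclic (p := v j) (q := v (j + 1)) (r := v (j + 2))
      (hpow i) (hpow i') a.ne_zero one_ne_zero ?_ ?_ ?_) ?_
    · rw [one_mul, e₀]
    · rw [one_mul, e₁, add_assoc]; rfl
    · rw [one_mul, e₂, add_assoc, (by decide : (1 + 2 : Fin 3) = 0), add_zero]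
    · fin_cases j <;> simp <;> grind
  · refine absurd (pow_three_eq_of_cyclic (p := v j') (q := v (j' + 1)) (r := v (j' + 2))
      (hpow i') (hpow i) one_ne_zero a.ne_zero ?_ ?_ ?_) ?_
    · rw [one_mul, e₀]
    · rw [one_mul, ← e₁, add_assoc]; rfl
    · rw [one_mul, ← e₂, add_assoc, (by decide : (1 + 2 : Fin 3) = 0), add_zero]
    · fin_cases j' <;> simp <;> grind

/-- (i) the `E₁₀₈`-orbit of `[1:0:0]` is the six-element set `orb₁`;
(ii) the `E₁₀₈`-orbit of `[1:ω:ω]` is the six-element set `orb₂`; (iii) neither of these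
sets has three collinear points and neither lies on a conic; (iv) every point of `ℙ²`
outside these two orbits has `E₁₀₈`-orbit with more than 8 elements. -/
theorem statement12 :
    (projOrbitSL E108 (pt 1 0 0 (vne₀ one_ne_zero)) = orb₁ ∧ orb₁.encard = 6) ∧
    (projOrbitSL E108 (pt 1 (zeta 3) (zeta 3) (vne₀ one_ne_zero)) = orb₂ ∧
      orb₂.encard = 6) ∧
    (NoThreeCollinear orb₁ ∧ ¬ LiesOnConic orb₁ ∧
      NoThreeCollinear orb₂ ∧ ¬ LiesOnConic orb₂) ∧
    (∀ X : P2, X ∉ orb₁ ∪ orb₂ → 8 < (projOrbitSL E108 X).encard) := by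
  refine ⟨⟨projOrbitSL_E108_eq_orb₁, ?_⟩, ⟨projOrbitSL_E108_eq_orb₂, ?_⟩,
    ⟨?_, not_liesOnConic_orb₁, ?_, not_liesOnConic_orb₂⟩, fun X hX => ?_⟩
  · rw [orb₁_eq_range]; exact encard_range_eq_six _ det_vecs₁_ne_zero
  · rw [orb₂_eq_range]; exact encard_range_eq_six _ det_vecs₂_ne_zero
  · rw [orb₁_eq_range]; exact noThreeCollinear_range _ det_vecs₁_ne_zero
  · rw [orb₂_eq_range]; exact noThreeCollinear_range _ det_vecs₂_ne_zero
  · refine lt_of_lt_of_le ?_ (Set.encard_le_encard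
      (Set.range_subset_iff.mpr fun ij : Fin 3 × Fin 3 => smul_mem_projOrbitSL
        (mul_mem (pow_mem sGen_mem ij.1) (pow_mem tGen_mem ij.2)) (mem_projOrbitSL_self E108 X)))
    rw [← Set.image_univ, (heisenberg_injective hX).encard_image, Set.encard_univ]
    simp
    norm_num
end
end

section
/- Let ρ : A₅ → GL(3,ℂ) be an injective group homomorphism from the alternating group on 5 letters, and let G = ρ(A₅) act on ℙ². Then there is exactly one G-orbit on ℙ² having at most 8 elements, and that orbit has exactly 6 elements. -/
open Matrix Complex

noncomputable section

abbrev GL3 : Type := GL (Fin 3) ℂ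

/-- The underlying set of matrices of a subgroup of `GL(3,ℂ)`. -/
def matSetGL (G : Subgroup GL3) : Set M3 := (fun g : GL3 => (g : M3)) '' (G : Set GL3)

abbrev A5 : Type := alternatingGroup (Fin 5)

section Matrices

lemma Matrix.eq_one_of_mulVec_eq_of_linearIndependent {M : M3} (hdet : M.det = 1) {n : ℕ}
    (hn : n ≠ 0) (hM : M ^ n = 1) {u v : Fin 3 → ℂ} (huv : LinearIndependent ℂ ![u, v])
    (hu : M *ᵥ u = u) (hv : M *ᵥ v = v) : M = 1 := by
  have hmem (w : Fin 3 → ℂ) : M *ᵥ w - w ∈ Submodule.span ℂ {u, v} := by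
    by_contra hw
    have hli : LinearIndependent ℂ ![M *ᵥ w - w, u, v] :=
      linearIndependent_finCons.2 ⟨huv, by simpa [Set.pair_comm v u] using hw⟩
    have hunit : IsUnit (Matrix.of ![M *ᵥ w - w, u, v]) :=
      Matrix.linearIndependent_rows_iff_isUnit.1 hli
    rw [Matrix.isUnit_iff_isUnit_det, isUnit_iff_ne_zero] at hunit
    apply hunit
    have hmul : Matrix.of ![M *ᵥ w, u, v] = Matrix.of ![w, u, v] * Mᵀ := by
      conv_lhs => rw [← hu, ← hv]
      ext i j
      fin_cases i <;>
        simp [Matrix.mul_apply, Matrix.mulVec, dotProduct, Fin.sum_univ_three, mul_comm]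
    have hdet' := congrArg Matrix.det hmul
    rw [Matrix.det_mul, Matrix.det_transpose, hdet, mul_one] at hdet'
    simp only [Matrix.det_fin_three, Matrix.of_apply, Matrix.cons_val, Pi.sub_apply] at hdet' ⊢
    linear_combination hdet'
  have hfix (w : Fin 3 → ℂ) : M *ᵥ (M *ᵥ w - w) = M *ᵥ w - w := by
    obtain ⟨a, b, hab⟩ := Submodule.mem_span_pair.1 (hmem w)
    rw [← hab, Matrix.mulVec_add, Matrix.mulVec_smul, Matrix.mulVec_smul, hu, hv]
  have hpow (k : ℕ) (w : Fin 3 → ℂ) : (M ^ k) *ᵥ w = w + (k : ℂ) • (M *ᵥ w - w) := by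
    induction k with
    | zero => simp
    | succ k ih =>
      rw [pow_succ', ← Matrix.mulVec_mulVec, ih, Matrix.mulVec_add, Matrix.mulVec_smul, hfix]
      push_cast
      module
  refine Matrix.ext_of_mulVec_single fun i => ?_
  have h := hpow n (Pi.single i 1)
  rw [hM, Matrix.one_mulVec, left_eq_add, smul_eq_zero, Nat.cast_eq_zero] at h
  rw [Matrix.one_mulVec]
  exact sub_eq_zero.1 (h.resolve_left hn)

lemma Matrix.exists_smul_eq_of_mulVec_eq {M : M3} (hdet : M.det = 1) {n : ℕ} (hn : n ≠ 0)
    (hM : M ^ n = 1) (hM1 : M ≠ 1) {u v : Fin 3 → ℂ} (hv0 : v ≠ 0) (hv : M *ᵥ v = v)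
    (hu : M *ᵥ u = u) : ∃ c : ℂ, c • v = u := by
  by_contra! h
  exact hM1 (eq_one_of_mulVec_eq_of_linearIndependent hdet hn hM
    ((LinearIndependent.pair_iff' hv0).2 h) hv hu)

lemma Matrix.exists_mulVec_eq_of_conj_inv {M N P : M3} (hdet : M.det = 1) (hMN : M * N = 1)
    (hP : IsUnit P) (hconj : P * M = N * P) : ∃ v ≠ 0, M *ᵥ v = v := by
  have h1 : (M - 1).det = (N - 1).det := by
    have h : P * (M - 1) = (N - 1) * P := by rw [mul_sub, sub_mul, hconj, mul_one, one_mul]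
    have h' := congrArg Matrix.det h
    rw [Matrix.det_mul, Matrix.det_mul, mul_comm] at h'
    exact mul_right_cancel₀ ((Matrix.isUnit_iff_isUnit_det P).1 hP).ne_zero h'
  have h2 : (N - 1).det = -(M - 1).det := by
    have h : M * (N - 1) = -(M - 1) := by rw [mul_sub, hMN, mul_one, neg_sub]
    have h' := congrArg Matrix.det h
    rw [Matrix.det_mul, hdet, one_mul, Matrix.det_neg] at h'
    simpa [Odd.neg_one_pow (by decide : Odd 3)] using h'
  have h3 : (M - 1).det = 0 := self_eq_neg.1 (h1.trans h2)
  obtain ⟨v, hv, h⟩ := Matrix.exists_mulVec_eq_zero_iff.2 h3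
  refine ⟨v, hv, ?_⟩
  rwa [Matrix.sub_mulVec, Matrix.one_mulVec, sub_eq_zero] at h

/-- Two distinct nontrivial commuting involutions of determinant one in `GL(3, ℂ)` have no
nonzero common fixed vector. -/
lemma Matrix.eq_zero_of_klein_four_mulVec_eq {A B : M3} (hA : A ^ 2 = 1) (hB : B ^ 2 = 1)
    (hA1 : A ≠ 1) (hB1 : B ≠ 1) (hne : A * B ≠ 1) (hcomm : A * B = B * A)
    (hdA : A.det = 1) (hdB : B.det = 1) {v : Fin 3 → ℂ} (hvA : A *ᵥ v = v) (hvB : B *ᵥ v = v) :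
    v = 0 := by
  by_contra hv
  have key {C : M3} (hC : C ^ 2 = 1) (hC1 : C ≠ 1) (hd : C.det = 1) (hvC : C *ᵥ v = v)
      (w : Fin 3 → ℂ) : ∃ c : ℂ, c • v = w + C *ᵥ w := by
    refine exists_smul_eq_of_mulVec_eq hd two_ne_zero hC hC1 hv hvC ?_
    rw [Matrix.mulVec_add, Matrix.mulVec_mulVec, ← sq, hC, Matrix.one_mulVec, add_comm]
  have hAB : (A * B) ^ 2 = 1 := by rw [(show Commute A B from hcomm).mul_pow, hA, hB, one_mul]
  have hle : Module.finrank ℂ (Fin 3 → ℂ) ≤ 1 := by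
    refine finrank_le_one v fun w => ?_
    obtain ⟨a, ha⟩ := key hA hA1 hdA hvA w
    obtain ⟨b, hb⟩ := key hB hB1 hdB hvB w
    obtain ⟨c, hc⟩ := key hAB hne (by rw [Matrix.det_mul, hdA, hdB, one_mul])
      (by rw [← Matrix.mulVec_mulVec, hvB, hvA]) w
    have hBw : B *ᵥ w = b • v - w := by rw [hb, add_sub_cancel_left]
    have hAw : A *ᵥ w = a • v - w := by rw [ha, add_sub_cancel_left]
    rw [← Matrix.mulVec_mulVec, hBw, Matrix.mulVec_sub, Matrix.mulVec_smul, hvA, hAw] at hc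
    refine ⟨(c - b + a) / 2, ?_⟩
    have h2 : (2 : ℂ) • w = (c - b + a) • v := by
      rw [add_smul, sub_smul, hc]; module
    rw [div_eq_inv_mul, mul_smul, ← h2, smul_smul]
    norm_num
  simp at hle

end Matrices

section Groups

local instance : Fact (Nat.Prime 5) := ⟨by norm_num⟩

variable {H : Type*} [Group H]

/-- In a group whose elements have order 1, 2, 3 or 5, a character which is nontrivial on an
element `x` and trivial on an involution `z` commuting with `x` excludes elements of order 3. -/
lemma eq_one_of_pow_three_of_char (hH : ∀ g : H, g ^ 2 = 1 ∨ g ^ 3 = 1 ∨ g ^ 5 = 1)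
    (χ : H →* ℂ) {x z s : H} (hz : z ^ 2 = 1) (hz1 : z ≠ 1)
    (hxz : x * z = z * x) (hχx : χ x = -1) (hχz : χ z = 1) (hs : s ^ 3 = 1) : s = 1 := by
  have hχs : χ s ^ 3 = 1 := by rw [← map_pow, hs, map_one]
  have hinv (y : H) (hy : χ y = -1) : (y * s) ^ 2 = 1 := by
    rcases hH (y * s) with h | h | h
    · exact h
    all_goals
      have h' := congrArg χ h
      simp only [map_pow, map_mul, map_one, hy] at h'
      exfalso
    · have : (-1 : ℂ) = 1 := by linear_combination h' + hχs
      norm_num at this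
    · have h2 : χ s ^ 2 = -1 := by linear_combination -h' - χ s ^ 2 * hχs
      have h3 : χ s = -1 := by linear_combination χ s * h2 - hχs
      norm_num [h3] at h2
  have h1 := hinv x hχx
  have h2 := hinv (x * z) (by rw [map_mul, hχx, hχz, mul_one])
  have hzs : Commute z s := by
    rw [sq] at *
    have e1 : x * s * x = s⁻¹ := eq_inv_of_mul_eq_one_left (by simpa [mul_assoc] using h1)
    have e2 : x * z * s * (x * z) = s⁻¹ :=
      eq_inv_of_mul_eq_one_left (by simpa [mul_assoc] using h2)
    have e3 : z * s⁻¹ * z = s⁻¹ := by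
      calc z * s⁻¹ * z = z * x * s * (x * z) := by rw [← e1]; simp only [mul_assoc]
        _ = s⁻¹ := by rw [← hxz, e2]
    have e4 : Commute z s⁻¹ := by
      calc z * s⁻¹ = z * s⁻¹ * (z * z) := by rw [hz, mul_one]
        _ = s⁻¹ * z := by rw [← mul_assoc, e3]
    exact inv_inv s ▸ e4.inv_right
  have hs2 (h : s ^ 2 = 1) : s = 1 := by rwa [pow_succ, h, one_mul] at hs
  rcases hH (z * s) with h | h | h <;> rw [hzs.mul_pow] at h
  · rw [hz, one_mul] at h
    exact hs2 h
  · rw [hs, mul_one, pow_succ, hz, one_mul] at h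
    exact absurd h hz1
  · have e : z = s := by
      have e5 : z ^ 5 = z := by rw [pow_succ, show 4 = 2 * 2 from rfl, pow_mul, hz]; simp
      have e6 : s ^ 5 = s⁻¹ := by
        rw [eq_inv_iff_mul_eq_one, ← pow_succ, show 5 + 1 = 3 * 2 from rfl, pow_mul, hs, one_pow]
      rw [e5, e6] at h
      exact mul_inv_eq_one.1 h
    exact hs2 (e ▸ hz)

lemma exists_klein_four [Finite H] (hH : ∀ g : H, g ^ 2 = 1 ∨ g ^ 3 = 1 ∨ g ^ 5 = 1)
    (hcard : 4 ∣ Nat.card H) :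
    ∃ a b : H, a ^ 2 = 1 ∧ b ^ 2 = 1 ∧ a ≠ 1 ∧ b ≠ 1 ∧ a ≠ b ∧ a * b = b * a := by
  obtain ⟨K, hK⟩ := Sylow.exists_subgroup_card_pow_prime 2 (n := 2) hcard
  have hsq (k : H) (hk : k ∈ K) : k ^ 2 = 1 := by
    have h4 : k ^ 4 = 1 := by
      have := pow_card_eq_one' (x := (⟨k, hk⟩ : K))
      rw [hK] at this
      exact congrArg Subtype.val this
    rcases hH k with h | h | h
    · exact h
    · rw [pow_succ, h, one_mul] at h4
      rw [h4, one_pow]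
    · rw [pow_succ, h4, one_mul] at h
      rw [h, one_pow]
  have hlt : 2 < (K : Set H).ncard := by
    change 2 < Nat.card K
    rw [hK]; norm_num
  obtain ⟨a, ha, ha1⟩ := Set.exists_mem_notMem_of_ncard_lt_ncard
    (s := {1}) (t := (K : Set H)) (by rw [Set.ncard_singleton]; omega)
  obtain ⟨b, hb, hb1⟩ := Set.exists_mem_notMem_of_ncard_lt_ncard
    (s := {1, a}) (t := (K : Set H)) ((Set.ncard_insert_le _ _).trans_lt (by
      rw [Set.ncard_singleton]; omega))
  simp only [Set.mem_insert_iff, Set.mem_singleton_iff, not_or] at ha1 hb1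
  refine ⟨a, b, hsq a ha, hsq b hb, ha1, hb1.1, fun h => hb1.2 h.symm, ?_⟩
  have hinv (k : H) (hk : k ∈ K) : k⁻¹ = k :=
    inv_eq_of_mul_eq_one_left (by rw [← sq, hsq k hk])
  rw [← hinv _ (K.mul_mem ha hb), _root_.mul_inv_rev, hinv a ha, hinv b hb]

lemma exists_klein_four_char_eq_one [Finite H]
    (hH : ∀ g : H, g ^ 2 = 1 ∨ g ^ 3 = 1 ∨ g ^ 5 = 1) (hcard : 12 ∣ Nat.card H) (χ : H →* ℂ) :
    ∃ a b : H, a ^ 2 = 1 ∧ b ^ 2 = 1 ∧ a ≠ 1 ∧ b ≠ 1 ∧ a ≠ b ∧ a * b = b * a ∧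
      χ a = 1 ∧ χ b = 1 := by
  obtain ⟨a, b, ha, hb, ha1, hb1, hab, hcomm⟩ :=
    exists_klein_four hH ((by norm_num : 4 ∣ 12).trans hcard)
  obtain ⟨s, hs⟩ := exists_prime_orderOf_dvd_card' 3 ((by norm_num : 3 ∣ 12).trans hcard)
  have hs3 : s ^ 3 = 1 := hs ▸ pow_orderOf_eq_one s
  have hs1 : s ≠ 1 := by rintro rfl; simp at hs
  have hχ (k : H) (hk : k ^ 2 = 1) : χ k = 1 ∨ χ k = -1 := by
    rw [← sq_eq_one_iff, ← map_pow, hk, map_one]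
  have hmul : (a * b) ^ 2 = 1 := by rw [(show Commute a b from hcomm).mul_pow, ha, hb, one_mul]
  have hmul1 : a * b ≠ 1 := fun h => hab <| by
    rw [← mul_one a, ← hb, sq, ← mul_assoc, h, one_mul]
  have key {x z : H} (hz : z ^ 2 = 1) (hz1 : z ≠ 1) (hxz : x * z = z * x)
      (hχx : χ x = -1) (hχz : χ z = 1) : False :=
    hs1 (eq_one_of_pow_three_of_char hH χ hz hz1 hxz hχx hχz hs3)
  refine ⟨a, b, ha, hb, ha1, hb1, hab, hcomm, ?_⟩
  rcases hχ a ha with h1 | h1 <;> rcases hχ b hb with h2 | h2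
  · exact ⟨h1, h2⟩
  · exact (key ha ha1 hcomm.symm h2 h1).elim
  · exact (key hb hb1 hcomm h1 h2).elim
  · refine (key hmul hmul1 ?_ h1 (by rw [map_mul, h1, h2]; norm_num)).elim
    rw [mul_assoc, hcomm]

lemma exists_order_five_char_eq_one (hH : ∀ g : H, g ^ 2 = 1 ∨ g ^ 3 = 1 ∨ g ^ 5 = 1)
    (hcard : Nat.card H = 10) (χ : H →* ℂ) : ∃ c : H, orderOf c = 5 ∧ χ c = 1 := by
  have : Finite H := Nat.finite_of_card_ne_zero (by omega)
  obtain ⟨c, hc⟩ := exists_prime_orderOf_dvd_card' (G := H) 5 (by rw [hcard]; norm_num)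
  obtain ⟨t, ht⟩ := exists_prime_orderOf_dvd_card' (G := H) 2 (by rw [hcard]; norm_num)
  refine ⟨c, hc, ?_⟩
  set C := Subgroup.zpowers c
  have hCcard : Nat.card C = 5 := by rw [Nat.card_zpowers, hc]
  have hC : C.index = 2 := by
    have := C.card_mul_index
    rw [hCcard, hcard] at this
    omega
  have htC : t ∉ C := fun h => by
    have := Subgroup.orderOf_dvd_natCard C h
    rw [ht, hCcard] at this
    norm_num at this
  have htc : t * c ∉ C := by
    rwa [Subgroup.mul_mem_iff_of_index_two hC, iff_true_right (Subgroup.mem_zpowers c)]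
  have hsq : (t * c) ^ 2 = 1 := by
    have h2 : (t * c) ^ 2 ∈ C := Subgroup.sq_mem_of_index_two hC _
    rcases hH (t * c) with h | h | h
    · exact h
    · refine absurd ?_ htc
      rw [pow_succ] at h
      exact eq_inv_of_mul_eq_one_right h ▸ C.inv_mem h2
    · refine absurd ?_ htc
      rw [pow_succ, show 4 = 2 * 2 from rfl, pow_mul] at h
      exact eq_inv_of_mul_eq_one_right h ▸ C.inv_mem (C.pow_mem h2 2)
  have e1 := congrArg χ hsq
  have e2 := congrArg χ (ht ▸ pow_orderOf_eq_one t)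
  have e3 := congrArg χ (hc ▸ pow_orderOf_eq_one c)
  simp only [map_pow, map_mul, map_one] at e1 e2 e3
  have e4 : χ c ^ 2 = 1 := by linear_combination e1 - χ c ^ 2 * e2
  linear_combination e3 - (χ c ^ 3 + χ c) * e4

lemma Subgroup.card_dvd_factorial_index [Finite H] [IsSimpleGroup H] {K : Subgroup H}
    (hK : K ≠ ⊤) : Nat.card H ∣ K.index.factorial := by
  have hbot : K.normalCore = ⊥ :=
    (K.normalCore_normal.eq_bot_or_eq_top).resolve_right fun h =>
      hK (top_le_iff.1 (h ▸ K.normalCore_le))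
  rw [← Subgroup.index_bot, ← hbot, Subgroup.normalCore_eq_ker, Subgroup.index_ker,
    Subgroup.index_eq_card, ← Nat.card_perm]
  exact Subgroup.card_subgroup_dvd_card _

set_option maxRecDepth 100000 in
lemma A5.pow_eq_one : ∀ g : A5, g ^ 2 = 1 ∨ g ^ 3 = 1 ∨ g ^ 5 = 1 := by decide

lemma A5.natCard : Nat.card A5 = 60 := by
  rw [nat_card_alternatingGroup, Nat.card_fin]
  rfl

lemma A5.index_eq_of_le_eight {K : Subgroup A5} (hK : K.index ≤ 8) :
    K.index = 1 ∨ K.index = 5 ∨ K.index = 6 := by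
  by_cases hT : K = ⊤
  · exact Or.inl (hT ▸ Subgroup.index_top)
  have h1 := Subgroup.card_dvd_factorial_index hT
  have h2 := K.index_dvd_card
  rw [A5.natCard] at h1 h2
  have h0 : K.index ≠ 0 := Subgroup.index_ne_zero_of_finite
  generalize K.index = k at *
  interval_cases k <;> simp_all [Nat.factorial]

/-- The cyclic subgroups of order five of `A₅` are Sylow subgroups, hence conjugate. -/
lemma A5.exists_conj_mem_zpowers {c d : A5} (hc : orderOf c = 5) (hd : orderOf d = 5) :
    ∃ g : A5, g * c * g⁻¹ ∈ Subgroup.zpowers d := by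
  have hfac : (5 : ℕ) = 5 ^ (Nat.card A5).factorization 5 := by
    rw [A5.natCard, show 60 = 5 * 12 from rfl, Nat.factorization_mul (by norm_num) (by norm_num)]
    simp [Nat.Prime.factorization_self (by norm_num : Nat.Prime 5),
      Nat.factorization_eq_zero_of_not_dvd (by norm_num : ¬ 5 ∣ 12)]
  let P : Sylow 5 A5 :=
    Sylow.ofCard (Subgroup.zpowers c) (by rw [Nat.card_zpowers, hc]; exact hfac)
  let Q : Sylow 5 A5 :=
    Sylow.ofCard (Subgroup.zpowers d) (by rw [Nat.card_zpowers, hd]; exact hfac)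
  obtain ⟨g, hg⟩ := MulAction.exists_smul_eq A5 P Q
  refine ⟨g, ?_⟩
  have h : g * c * g⁻¹ ∈ (g • P : Sylow 5 A5) := by
    rw [← MulAut.conj_apply]
    exact Subgroup.smul_mem_pointwise_smul c (MulAut.conj g) (P : Subgroup A5)
      (Subgroup.mem_zpowers c)
  rw [hg] at h
  exact h

/-- A five-cycle and an involution inverting it. -/
lemma A5.exists_dihedral : ∃ c t : A5, orderOf c = 5 ∧ orderOf t = 2 ∧ t * c = c⁻¹ * t := by
  refine ⟨⟨c[0, 1, 2, 3, 4], Equiv.Perm.mem_alternatingGroup.2 (by decide)⟩,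
    ⟨c[1, 4] * c[2, 3], Equiv.Perm.mem_alternatingGroup.2 (by decide)⟩, ?_, ?_, by decide⟩
  · exact orderOf_eq_prime (by decide) (by decide)
  · exact orderOf_eq_prime (by decide) (by decide)

end Groups

section Representation

variable (ρ : A5 →* GL3)

lemma det_rho_eq_one (g : A5) : (ρ g : M3).det = 1 := by
  have h := Abelianization.commutator_subset_ker (Matrix.GeneralLinearGroup.det.comp ρ)
  rw [commutator_alternatingGroup_eq_top (by simp)] at h
  exact congrArg Units.val (MonoidHom.mem_ker.1 (h (Subgroup.mem_top g)))

variable {ρ} in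
lemma rho_ne_one (hρ : Function.Injective ρ) {g : A5} (hg : g ≠ 1) : (ρ g : M3) ≠ 1 := fun h =>
  hg ((map_eq_one_iff ρ hρ).1 (Units.ext h))

lemma rho_pow {g : A5} {n : ℕ} (hg : g ^ n = 1) : (ρ g : M3) ^ n = 1 := by
  rw [← Units.val_pow_eq_pow_val, ← map_pow, hg, map_one, Units.val_one]

lemma rho_mul_mulVec (g h : A5) (v : Fin 3 → ℂ) :
    (ρ (g * h) : M3) *ᵥ v = (ρ g : M3) *ᵥ ((ρ h : M3) *ᵥ v) := by
  rw [map_mul, Units.val_mul, Matrix.mulVec_mulVec]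

variable {ρ} in
lemma exists_smul_eq_of_rho_mulVec_eq (hρ : Function.Injective ρ) {g : A5} (hg : g ≠ 1)
    {u v : Fin 3 → ℂ} (hv0 : v ≠ 0) (hv : (ρ g : M3) *ᵥ v = v) (hu : (ρ g : M3) *ᵥ u = u) :
    ∃ c : ℂ, c • v = u :=
  Matrix.exists_smul_eq_of_mulVec_eq (det_rho_eq_one ρ g) (orderOf_pos g).ne'
    (rho_pow ρ (pow_orderOf_eq_one g)) (rho_ne_one hρ hg) hv0 hv hu

/-- The action of `A₅` on `ℙ²` induced by a three-dimensional representation. -/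
abbrev projAction : MulAction A5 P2 :=
  MulAction.compHom P2 ((Matrix.GeneralLinearGroup.toLin (n := Fin 3) (R := ℂ)).toMonoidHom.comp ρ)

lemma rho_mulVec_ne_zero (g : A5) {v : Fin 3 → ℂ} (hv : v ≠ 0) : (ρ g : M3) *ᵥ v ≠ 0 := fun h =>
  hv (by rw [← Matrix.one_mulVec v, ← Units.inv_mul (ρ g), ← Matrix.mulVec_mulVec, h,
    Matrix.mulVec_zero])

lemma projAction_smul_mk (g : A5) {v : Fin 3 → ℂ} (hv : v ≠ 0) :
    (projAction ρ).toSMul.smul g (Projectivization.mk ℂ v hv) =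
      Projectivization.mk ℂ ((ρ g : M3) *ᵥ v) (rho_mulVec_ne_zero ρ g hv) := rfl

lemma projOrbit_eq_orbit (p : P2) :
    projOrbit (matSetGL ρ.range) p = @MulAction.orbit A5 P2 (projAction ρ).toSMul p := by
  ext q
  constructor
  · rintro ⟨_, ⟨_, ⟨g, rfl⟩, rfl⟩, h, rfl⟩
    refine ⟨g, ?_⟩
    change (projAction ρ).toSMul.smul g p = _
    conv_lhs => rw [← p.mk_rep]
    exact projAction_smul_mk ρ g p.rep_nonzero
  · rintro ⟨g, rfl⟩
    refine ⟨_, ⟨_, ⟨g, rfl⟩, rfl⟩, rho_mulVec_ne_zero ρ g p.rep_nonzero, ?_⟩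
    change _ = (projAction ρ).toSMul.smul g p
    conv_rhs => rw [← p.mk_rep]
    exact (projAction_smul_mk ρ g p.rep_nonzero).symm

/-- The stabilizer in `A₅` of a point of `ℙ²`. -/
abbrev projStabilizer (p : P2) : Subgroup A5 :=
  letI := projAction ρ
  MulAction.stabilizer A5 p

lemma encard_projOrbit (p : P2) :
    (projOrbit (matSetGL ρ.range) p).encard = (projStabilizer ρ p).index := by
  let := projAction ρ
  rw [projOrbit_eq_orbit, MulAction.index_stabilizer]
  exact (Set.Finite.cast_ncard_eq (Set.finite_range _)).symm

lemma mem_projStabilizer_mk {g : A5} {v : Fin 3 → ℂ} (hv : v ≠ 0) :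
    g ∈ projStabilizer ρ (Projectivization.mk ℂ v hv) ↔ ∃ a : ℂ, (ρ g : M3) *ᵥ v = a • v := by
  let := projAction ρ
  rw [MulAction.mem_stabilizer_iff]
  change (projAction ρ).toSMul.smul g _ = _ ↔ _
  rw [projAction_smul_mk, Projectivization.mk_eq_mk_iff']
  simp only [eq_comm]

/-- A subgroup of `A₅` fixing the line spanned by `v` acts on that line by a character. -/
lemma exists_char {K : Subgroup A5} {v : Fin 3 → ℂ} (hv : v ≠ 0)
    (hK : ∀ g ∈ K, ∃ a : ℂ, (ρ g : M3) *ᵥ v = a • v) :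
    ∃ χ : K →* ℂ, ∀ g : K, (ρ g : M3) *ᵥ v = χ g • v := by
  choose f hf using fun g : K => hK g g.2
  refine ⟨⟨⟨f, ?_⟩, fun g h => ?_⟩, hf⟩
  · refine smul_left_injective ℂ hv ?_
    simp only [← hf, Subgroup.coe_one, map_one, Units.val_one, Matrix.one_mulVec, one_smul]
  · refine smul_left_injective ℂ hv ?_
    simp only [← hf, Subgroup.coe_mul, rho_mul_mulVec]
    rw [hf h, Matrix.mulVec_smul, hf g, smul_smul, mul_comm]

variable {ρ}

lemma not_dvd_natCard_of_rho_stable (hρ : Function.Injective ρ) {K : Subgroup A5}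
    {v : Fin 3 → ℂ} (hv : v ≠ 0) (hK : ∀ g ∈ K, ∃ a : ℂ, (ρ g : M3) *ᵥ v = a • v) :
    ¬ 12 ∣ Nat.card K := by
  intro hcard
  obtain ⟨χ, hχ⟩ := exists_char ρ hv hK
  obtain ⟨⟨a, ha'⟩, ⟨b, hb'⟩, ha, hb, ha1, hb1, hab, hcomm, hχa, hχb⟩ :=
    exists_klein_four_char_eq_one
      (fun g => by simpa [Subtype.ext_iff] using A5.pow_eq_one (g : A5)) hcard χ
  have hva := hχ ⟨a, ha'⟩
  have hvb := hχ ⟨b, hb'⟩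
  rw [hχa, one_smul] at hva
  rw [hχb, one_smul] at hvb
  replace ha : a ^ 2 = 1 := congrArg Subtype.val ha
  replace hb : b ^ 2 = 1 := congrArg Subtype.val hb
  replace ha1 : a ≠ 1 := fun h => ha1 (Subtype.ext h)
  replace hb1 : b ≠ 1 := fun h => hb1 (Subtype.ext h)
  replace hab : a ≠ b := fun h => hab (Subtype.ext h)
  replace hcomm : a * b = b * a := congrArg Subtype.val hcomm
  have hmul : a * b ≠ 1 := fun h => hab <| by
    rw [← mul_one a, ← hb, sq, ← mul_assoc, h, one_mul]
  refine hv (Matrix.eq_zero_of_klein_four_mulVec_eq (rho_pow ρ ha) (rho_pow ρ hb)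
    (rho_ne_one hρ ha1) (rho_ne_one hρ hb1) ?_ ?_ (det_rho_eq_one ρ a) (det_rho_eq_one ρ b)
    hva hvb)
  · rw [← Units.val_mul, ← map_mul]
    exact rho_ne_one hρ hmul
  · rw [← Units.val_mul, ← map_mul, hcomm, map_mul, Units.val_mul]

lemma index_projStabilizer_eq_six (hρ : Function.Injective ρ) {p : P2}
    (hp : (projStabilizer ρ p).index ≤ 8) : (projStabilizer ρ p).index = 6 := by
  have hcard := (projStabilizer ρ p).card_mul_index
  rw [A5.natCard] at hcard
  induction p using Projectivization.ind with
  | h v hv =>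
    have hnot := not_dvd_natCard_of_rho_stable hρ hv
      fun g hg => (mem_projStabilizer_mk ρ hv).1 hg
    rcases A5.index_eq_of_le_eight hp with h | h | h
    · rw [h] at hcard
      exact absurd ⟨5, by omega⟩ hnot
    · rw [h] at hcard
      exact absurd ⟨1, by omega⟩ hnot
    · exact h

lemma exists_order_five_rho_mulVec_eq {v : Fin 3 → ℂ} (hv : v ≠ 0)
    (hp : (projStabilizer ρ (Projectivization.mk ℂ v hv)).index = 6) :
    ∃ c : A5, orderOf c = 5 ∧ (ρ c : M3) *ᵥ v = v := by
  obtain ⟨χ, hχ⟩ := exists_char ρ hv fun g hg => (mem_projStabilizer_mk ρ hv).1 hg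
  have hcard := (projStabilizer ρ (Projectivization.mk ℂ v hv)).card_mul_index
  rw [A5.natCard, hp] at hcard
  obtain ⟨c, hc, hχc⟩ := exists_order_five_char_eq_one
    (fun g => by simpa [Subtype.ext_iff] using A5.pow_eq_one (g : A5)) (by omega) χ
  refine ⟨c, by rwa [Subgroup.orderOf_coe], ?_⟩
  rw [hχ c, hχc, one_smul]

lemma mem_orbit_of_rho_mulVec_eq (hρ : Function.Injective ρ) {c d : A5} (hc : orderOf c = 5)
    (hd : orderOf d = 5) {u v : Fin 3 → ℂ} (hu0 : u ≠ 0) (hv0 : v ≠ 0)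
    (hu : (ρ c : M3) *ᵥ u = u) (hv : (ρ d : M3) *ᵥ v = v) :
    Projectivization.mk ℂ v hv0 ∈
      @MulAction.orbit A5 P2 (projAction ρ).toSMul (Projectivization.mk ℂ u hu0) := by
  obtain ⟨g, k, hg⟩ := A5.exists_conj_mem_zpowers hc hd
  have hne : g * c * g⁻¹ ≠ 1 := by
    rw [Ne, conj_eq_one_iff]
    rintro rfl
    simp at hc
  have hstab : (ρ (g * c * g⁻¹) : M3) *ᵥ v = v := by
    have hmem : g * c * g⁻¹ ∈ Subgroup.zpowers d := ⟨k, hg⟩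
    obtain ⟨n, hn⟩ := (isOfFinOrder_of_finite d).mem_powers_iff_mem_zpowers.2 hmem
    rw [← hn]
    clear hn
    induction n with
    | zero => simp
    | succ n ih =>
      change (ρ (d ^ (n + 1)) : M3) *ᵥ v = v
      rw [pow_succ, rho_mul_mulVec, hv]
      exact ih
  have hfix : (ρ (g * c * g⁻¹) : M3) *ᵥ ((ρ g : M3) *ᵥ u) = (ρ g : M3) *ᵥ u := by
    rw [← rho_mul_mulVec, inv_mul_cancel_right, rho_mul_mulVec, hu]
  obtain ⟨a, ha⟩ := exists_smul_eq_of_rho_mulVec_eq hρ hne hv0 hstab hfix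
  refine ⟨g, ?_⟩
  change (projAction ρ).toSMul.smul g _ = _
  rw [projAction_smul_mk, Projectivization.mk_eq_mk_iff']
  exact ⟨a, ha⟩

lemma exists_index_projStabilizer_le (hρ : Function.Injective ρ) :
    ∃ p : P2, (projStabilizer ρ p).index ≤ 8 := by
  obtain ⟨c, t, hc, ht, hct⟩ := A5.exists_dihedral
  have hct' : (ρ t : M3) * (ρ c : M3) = (ρ c⁻¹ : M3) * (ρ t : M3) := by
    rw [← Units.val_mul, ← Units.val_mul, ← map_mul, ← map_mul, hct]
  obtain ⟨v, hv0, hv⟩ := Matrix.exists_mulVec_eq_of_conj_inv (N := (ρ c⁻¹ : M3))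
    (det_rho_eq_one ρ c) (by rw [← Units.val_mul, ← map_mul, mul_inv_cancel]; simp)
    (ρ t).isUnit hct'
  have hcinv : (ρ c⁻¹ : M3) *ᵥ v = v := by
    conv_lhs => rw [← hv]
    rw [← rho_mul_mulVec, inv_mul_cancel]
    simp
  have hc1 : c ≠ 1 := by rintro rfl; simp at hc
  obtain ⟨a, ha⟩ := exists_smul_eq_of_rho_mulVec_eq (u := (ρ t : M3) *ᵥ v) hρ
    (inv_ne_one.2 hc1) hv0 hcinv (by rw [← rho_mul_mulVec, ← hct, rho_mul_mulVec, hv])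
  refine ⟨Projectivization.mk ℂ v hv0, ?_⟩
  set K := projStabilizer ρ (Projectivization.mk ℂ v hv0)
  have hcK : c ∈ K := (mem_projStabilizer_mk ρ hv0).2 ⟨1, by rw [hv, one_smul]⟩
  have htK : t ∈ K := (mem_projStabilizer_mk ρ hv0).2 ⟨a, ha.symm⟩
  have h5 := hc ▸ Subgroup.orderOf_dvd_natCard K hcK
  have h2 := ht ▸ Subgroup.orderOf_dvd_natCard K htK
  have h10 : 10 ∣ Nat.card K := (by norm_num : Nat.Coprime 2 5).mul_dvd_of_dvd_of_dvd h2 h5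
  have hcard := K.card_mul_index
  rw [A5.natCard] at hcard
  obtain ⟨m, hm⟩ := h10
  rw [hm] at hcard
  have h6 : K.index ∣ 6 := ⟨m, by linarith⟩
  exact (Nat.le_of_dvd (by norm_num) h6).trans (by norm_num)

end Representation

/-- if `ρ : A₅ → GL(3,ℂ)` is an injective group homomorphism and
`G = ρ(A₅)`, then there is exactly one `G`-orbit on `ℙ²` with at most 8 elements, and that
orbit has exactly 6 elements. -/
theorem statement14 (ρ : ↥(alternatingGroup (Fin 5)) →* GL3) (hρ : Function.Injective ρ) :
    (∃! O : Set P2, (∃ p : P2, O = projOrbit (matSetGL ρ.range) p) ∧ O.encard ≤ 8) ∧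
    (∀ p : P2, (projOrbit (matSetGL ρ.range) p).encard ≤ 8 →
      (projOrbit (matSetGL ρ.range) p).encard = 6) := by
  have hiff (p : P2) : (projOrbit (matSetGL ρ.range) p).encard ≤ 8 ↔
      (projStabilizer ρ p).index ≤ 8 := by
    rw [encard_projOrbit]
    exact Nat.cast_le (α := ℕ∞) (n := 8)
  have hsix (p : P2) (hp : (projOrbit (matSetGL ρ.range) p).encard ≤ 8) :
      (projStabilizer ρ p).index = 6 := index_projStabilizer_eq_six hρ ((hiff p).1 hp)
  obtain ⟨p, hp⟩ := exists_index_projStabilizer_le hρ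
  refine ⟨⟨_, ⟨⟨p, rfl⟩, (hiff p).2 hp⟩, ?_⟩, fun q hq => ?_⟩
  · rintro _ ⟨⟨q, rfl⟩, hq⟩
    have hp6 := hsix p ((hiff p).2 hp)
    have hq6 := hsix q hq
    induction p using Projectivization.ind with
    | h v hv =>
      induction q using Projectivization.ind with
      | h u hu =>
        obtain ⟨c, hc, hcv⟩ := exists_order_five_rho_mulVec_eq hv hp6
        obtain ⟨d, hd, hdu⟩ := exists_order_five_rho_mulVec_eq hu hq6
        rw [projOrbit_eq_orbit, projOrbit_eq_orbit]
        let := projAction ρ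
        exact MulAction.orbit_eq_iff.2 (mem_orbit_of_rho_mulVec_eq hρ hc hd hv hu hcv hdu)
  · rw [encard_projOrbit, hsix q hq]
    rfl
end
end

section
/- Let ρ : A₅ → GL(3,ℂ) be an injective group homomorphism from the alternating group on 5 letters, let G = ρ(A₅) act on ℙ², and let Ω be the unique G-orbit on ℙ² with exactly 6 elements. Then: (i) no three distinct points of Ω are collinear; (ii) Ω does not lie on a conic; (iii) G acts transitively on the lines through pairs of points of Ω, i.e., for any two pairs {p,q} and {p',q'} of distinct points of Ω there exists g ∈ G whose image of the 2-dimensional subspace of ℂ³ spanned by representatives of p and q is the 2-dimensional subspace spanned by representatives of p' and q'. -/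
open Matrix Complex

noncomputable section

section ActionOfA5

open MulAction

set_option maxRecDepth 100000 in
lemma perm_five_sq_eq_one {σ : Equiv.Perm (Fin 5)} (h : σ ^ 10 = 1) (h5 : σ ^ 5 ≠ 1) :
    σ ^ 2 = 1 := by
  revert σ; decide

/-- A subgroup of order 10 of `A₅` is dihedral. -/
lemma exists_dihedral_generators {H : Subgroup (alternatingGroup (Fin 5))} (hH : Nat.card H = 10) :
    ∃ t ∈ H, ∃ s ∈ H, orderOf t = 5 ∧ orderOf s = 2 ∧ s * t = t⁻¹ * s := by
  obtain ⟨t, ht⟩ := exists_prime_orderOf_dvd_card' (G := H) 5 (hp := ⟨by norm_num⟩) (by simp [hH])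
  obtain ⟨s, hs⟩ := exists_prime_orderOf_dvd_card' (G := H) 2 (hp := ⟨by norm_num⟩) (by simp [hH])
  have hindex : (Subgroup.zpowers t).index = 2 := by
    have := (Subgroup.zpowers t).card_mul_index
    rw [Nat.card_zpowers, ht, hH] at this
    lia
  have hsN : s ∉ Subgroup.zpowers t := fun h => by
    have := orderOf_dvd_of_mem_zpowers h
    rw [hs, ht] at this
    norm_num at this
  have htsN : t * s ∉ Subgroup.zpowers t := fun h =>
    hsN (((Subgroup.mul_mem_iff_of_index_two hindex).1 h).1 (Subgroup.mem_zpowers t))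
  have h5 : (t * s) ^ 5 ≠ 1 := fun h => htsN <| by
    rw [← Subgroup.mul_mem_cancel_left _
      (pow_mem (Subgroup.sq_mem_of_index_two hindex (t * s)) 2), ← pow_mul, ← pow_succ, h]
    exact one_mem _
  have h10 : (t * s) ^ 10 = 1 := by rw [← hH]; exact pow_card_eq_one'
  have h2 : (t * s) ^ 2 = 1 := by
    have := perm_five_sq_eq_one (σ := ((t * s : H) : alternatingGroup (Fin 5)))
      (by exact_mod_cast h10) (by exact_mod_cast h5)
    exact_mod_cast this
  refine ⟨t, t.2, s, s.2, by simpa using ht, by simpa using hs, ?_⟩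
  have hss : s⁻¹ = s := by
    rw [inv_eq_iff_mul_eq_one, ← pow_two, ← hs, pow_orderOf_eq_one]
  have : s * t = t⁻¹ * s := by
    rw [eq_inv_mul_iff_mul_eq, ← mul_assoc, ← mul_inv_eq_one, hss, mul_assoc, ← pow_two, h2]
  exact_mod_cast this

/-- In a nontrivial transitive action of `A₅`, only the identity acts trivially. -/
lemma exists_smul_ne_of_mem_orbit {X : Type*} [MulAction (alternatingGroup (Fin 5)) X] {p : X}
    (hp : (orbit (alternatingGroup (Fin 5)) p).Nontrivial) {t : alternatingGroup (Fin 5)}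
    (ht : t ≠ 1) : ∃ w ∈ orbit (alternatingGroup (Fin 5)) p, t • w ≠ w := by
  by_contra! h
  have hker : (toPermHom (alternatingGroup (Fin 5))
      (orbit (alternatingGroup (Fin 5)) p)).ker = ⊤ := by
    refine (Subgroup.Normal.eq_bot_or_eq_top inferInstance).resolve_left fun hbot => ht ?_
    rw [← Subgroup.mem_bot, ← hbot, MonoidHom.mem_ker]
    ext x
    exact h x x.2
  obtain ⟨q, hq, hqp⟩ := hp.exists_ne p
  obtain ⟨g, rfl⟩ := hq
  have hg : g ∈ (toPermHom (alternatingGroup (Fin 5))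
      (orbit (alternatingGroup (Fin 5)) p)).ker := hker ▸ Subgroup.mem_top g
  exact hqp (congrArg Subtype.val (Equiv.ext_iff.1 (MonoidHom.mem_ker.1 hg) ⟨p, mem_orbit_self p⟩))

lemma pow_smul_injective_of_prime {G X : Type*} [Group G] [MulAction G X] {q : ℕ}
    [hq : Fact q.Prime] {t : G} (ht : t ^ q = 1) {w : X} (hw : t • w ≠ w) :
    Function.Injective fun i : Fin q => t ^ (i : ℕ) • w := by
  have hper : Function.minimalPeriod (t • ·) w = q :=
    Function.minimalPeriod_eq_prime
      (by simpa [Function.IsPeriodicPt, Function.IsFixedPt, smul_iterate]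
        using congrArg (· • w) ht)
      (by simpa [Function.IsFixedPt] using hw)
  intro i j hij
  have := (Function.iterate_eq_iterate_iff_of_lt_minimalPeriod (f := (t • ·)) (x := w)
    (by rw [hper]; exact i.2) (by rw [hper]; exact j.2)).1 (by simpa [smul_iterate] using hij)
  exact Fin.ext this

/-- An orbit with `q + 1` elements containing a fixed point and a non-fixed point of an element
of prime order `q`. -/
lemma orbit_eq_insert_range_pow_smul {G X : Type*} [Group G] [MulAction G X] {q : ℕ}
    [hq : Fact q.Prime] {p w : X} (hp : (orbit G p).ncard = q + 1) {t : G} (ht : t ^ q = 1)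
    (htp : t • p = p) (hwp : w ∈ orbit G p) (hw : t • w ≠ w) :
    orbit G p = insert p (Set.range fun i : Fin q => t ^ (i : ℕ) • w) := by
  refine (Set.eq_of_subset_of_ncard_le ?_ ?_ (Set.finite_of_ncard_pos (by lia))).symm
  · rintro _ (rfl | ⟨i, rfl⟩)
    · exact mem_orbit_self _
    · exact mem_orbit_of_mem_orbit _ hwp
  · rw [hp, Set.ncard_insert_of_notMem, Set.ncard_range_of_injective
      (pow_smul_injective_of_prime ht hw)]
    · simp
    · rintro ⟨i, h⟩
      have h' : t ^ (i : ℕ) • w = p := h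
      rw [smul_eq_iff_eq_inv_smul] at h'
      have : (t ^ (i : ℕ))⁻¹ • p = p := by
        rw [inv_smul_eq_iff]
        exact (mem_stabilizer_iff.1 (pow_mem (mem_stabilizer_iff.2 htp) i)).symm
      exact hw (by rw [h', this, htp])

/-- The structure of the action of `A₅` on an orbit with six elements. -/
lemma exists_dihedral_orbit {X : Type*} [MulAction (alternatingGroup (Fin 5)) X] {p : X}
    (hp : (orbit (alternatingGroup (Fin 5)) p).ncard = 6) :
    ∃ (t s : alternatingGroup (Fin 5)) (w : X), t ≠ 1 ∧ t ^ 5 = 1 ∧ s ^ 2 = 1 ∧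
      s * t = t⁻¹ * s ∧ t • p = p ∧ s • p = p ∧ s • w = w ∧ t • w ≠ w ∧
      orbit (alternatingGroup (Fin 5)) p =
        insert p (Set.range fun i : Fin 5 => t ^ (i : ℕ) • w) := by
  have hcard : Nat.card (stabilizer (alternatingGroup (Fin 5)) p) = 10 := by
    have h := (stabilizer (alternatingGroup (Fin 5)) p).card_mul_index
    rw [index_stabilizer, hp, nat_card_alternatingGroup, Nat.card_fin,
      show Nat.factorial 5 / 2 = 60 from rfl] at h
    lia
  obtain ⟨t, htp, s, hsp, ht, hs, hst⟩ := exists_dihedral_generators hcard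
  rw [mem_stabilizer_iff] at htp hsp
  have ht1 : t ≠ 1 := by rintro rfl; simp at ht
  have ht5 : t ^ 5 = 1 := orderOf_dvd_iff_pow_eq_one.1 ht.dvd
  have hs2 : s ^ 2 = 1 := orderOf_dvd_iff_pow_eq_one.1 hs.dvd
  have : Fact (Nat.Prime 5) := ⟨by norm_num⟩
  have hfin : (orbit (alternatingGroup (Fin 5)) p).Finite := Set.finite_of_ncard_pos (by lia)
  obtain ⟨w, hwp, hw⟩ := exists_smul_ne_of_mem_orbit
    ((Set.one_lt_ncard hfin).1 (by lia) : (orbit _ p).Nontrivial) ht1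
  have hst' (i : ℕ) : s * t ^ i = (t ^ i)⁻¹ * s := by
    rw [← inv_pow]
    exact (SemiconjBy.pow_right hst i)
  obtain ⟨j, hj⟩ : ∃ j : Fin 5, t ^ (j : ℕ) • w = s • w := by
    have : s • w ∈ orbit (alternatingGroup (Fin 5)) p := mem_orbit_of_mem_orbit _ hwp
    rw [orbit_eq_insert_range_pow_smul hp ht5 htp hwp hw] at this
    refine this.resolve_left fun h => hw ?_
    have hwp' : w = p := smul_left_cancel s (h.trans hsp.symm)
    rw [hwp', htp]
  have hfix : t • t ^ (3 * (j : ℕ)) • w ≠ t ^ (3 * (j : ℕ)) • w := by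
    rw [smul_smul, ((Commute.refl t).pow_right _).eq, mul_smul]
    exact fun h => hw (smul_left_cancel _ h)
  refine ⟨t, s, t ^ (3 * (j : ℕ)) • w, ht1, ht5, hs2, hst, htp, hsp, ?_, hfix,
    orbit_eq_insert_range_pow_smul hp ht5 htp (mem_orbit_of_mem_orbit _ hwp) hfix⟩
  rw [smul_smul, hst', mul_smul, ← hj, inv_smul_eq_iff, smul_smul, ← pow_add,
    show 3 * (j : ℕ) + 3 * j = 5 * j + j by lia, pow_add, pow_mul, ht5, one_pow, one_mul]

/-- If the stabilizer of a point is transitive on the rest of its orbit, the action on the orbit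
is doubly transitive. -/
lemma exists_smul_eq_and_smul_eq {G X : Type*} [Group G] [MulAction G X] {q : ℕ} {p w : X} {t : G}
    (htp : t • p = p)
    (horb : orbit G p = insert p (Set.range fun i : Fin q => t ^ (i : ℕ) • w))
    {x y : X} (hx : x ∈ orbit G p) (hy : y ∈ orbit G p) (hxy : x ≠ y) :
    ∃ g : G, g • x = p ∧ g • y = w := by
  obtain ⟨h, rfl⟩ := hx
  have hy' : h⁻¹ • y ∈ orbit G p := mem_orbit_of_mem_orbit _ hy
  rw [horb] at hy'
  rcases hy' with hy' | ⟨i, hi⟩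
  · exact absurd (inv_smul_eq_iff.1 hy').symm hxy
  · refine ⟨(t ^ (i : ℕ))⁻¹ * h⁻¹, ?_, ?_⟩
    · rw [mul_smul, inv_smul_smul, inv_smul_eq_iff]
      exact (mem_stabilizer_iff.1 (pow_mem (mem_stabilizer_iff.2 htp) i)).symm
    · rw [mul_smul, ← hi, inv_smul_smul]

section Dihedral

open Module

variable {V : Type*} [AddCommGroup V] [Module ℂ V]

/-- A nontrivial operator of order `5` has a primitive fifth root of unity as eigenvalue. -/
lemma exists_primitiveRoot_hasEigenvector [FiniteDimensional ℂ V] {T : End ℂ V} (hT : T ≠ 1)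
    (hT5 : T ^ 5 = 1) : ∃ (ζ : ℂ) (e : V), IsPrimitiveRoot ζ 5 ∧ T.HasEigenvector ζ e := by
  have hΦ : Polynomial.aeval T (Polynomial.cyclotomic 5 ℂ) * (T - 1) = 0 := by
    have : Fact (Nat.Prime 5) := ⟨by norm_num⟩
    have := congrArg (Polynomial.aeval T) (Polynomial.cyclotomic_prime_mul_X_sub_one ℂ 5)
    simpa [hT5] using this
  have h0 : (0 : ℂ) ∈ spectrum ℂ (Polynomial.aeval T (Polynomial.cyclotomic 5 ℂ)) := by
    rw [spectrum.zero_mem_iff]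
    intro hu
    exact hT (sub_eq_zero.1 ((hu.mul_right_eq_zero).1 hΦ))
  rw [spectrum.map_polynomial_aeval_of_degree_pos _ _ (Polynomial.degree_cyclotomic_pos 5 ℂ
    (by norm_num))] at h0
  obtain ⟨ζ, hζ, hζ0⟩ := h0
  obtain ⟨e, he⟩ := (End.hasEigenvalue_iff_mem_spectrum.2 hζ).exists_hasEigenvector
  exact ⟨ζ, e, (Polynomial.isRoot_cyclotomic_iff).1 hζ0, he⟩

lemma pow_apply_of_apply_eq_smul {T : End ℂ V} {c : ℂ} {x : V} (h : T x = c • x) (n : ℕ) :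
    (T ^ n) x = c ^ n • x := by
  induction n with
  | zero => simp
  | succ n ih => rw [pow_succ', End.mul_apply, ih, map_smul, h, smul_smul, pow_succ]

/-- Normal form of a three-dimensional representation of the dihedral group of order `10`. -/
lemma exists_dihedral_basis (hV : finrank ℂ V = 3) {T S : End ℂ V} (hT : T ≠ 1) (hT5 : T ^ 5 = 1)
    (hS : S ^ 2 = 1) (hTST : T * S * T = S) {v : V} (hv : v ≠ 0) {c μ : ℂ} (hTv : T v = c • v)
    (hSv : S v = μ • v) :
    ∃ (ζ : ℂ) (β : Basis (Fin 3) ℂ V), IsPrimitiveRoot ζ 5 ∧ β 0 = v ∧ T (β 0) = β 0 ∧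
      T (β 1) = ζ • β 1 ∧ T (β 2) = ζ⁻¹ • β 2 ∧ S (β 1) = β 2 ∧ S (β 2) = β 1 := by
  have : FiniteDimensional ℂ V := FiniteDimensional.of_finrank_pos (by lia)
  obtain ⟨ζ, e, hζ, he⟩ := exists_primitiveRoot_hasEigenvector hT hT5
  have hζ0 : ζ ≠ 0 := hζ.ne_zero (by norm_num)
  have hSS (x : V) : S (S x) = x := by simpa [pow_two] using LinearMap.congr_fun hS x
  have hTST' (x : V) : T (S (T x)) = S x := LinearMap.congr_fun hTST x
  have hTe : T e = ζ • e := he.apply_eq_smul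
  have hTSe : T (S e) = ζ⁻¹ • S e := by
    rw [eq_inv_smul_iff₀ hζ0, ← map_smul, ← map_smul, ← hTe, hTST']
  have hTv' : T v = v := by
    have hc5 : c ^ 5 = 1 := by
      have h := pow_apply_of_apply_eq_smul hTv 5
      rw [hT5, End.one_apply] at h
      exact smul_left_injective ℂ hv (by simpa using h.symm)
    have hμ : μ ≠ 0 := by
      rintro rfl
      exact hv (by rw [← hSS v, hSv, zero_smul, map_zero])
    have hc2 : c ^ 2 = 1 := by
      have h := hTST' v
      rw [hTv, map_smul, hSv, map_smul, map_smul, hTv, smul_smul, smul_smul] at h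
      have := smul_left_injective ℂ hv h
      exact mul_right_cancel₀ hμ (by linear_combination this)
    rw [hTv, show c = 1 by linear_combination hc5 - (c ^ 3 + c) * hc2, one_smul]
  have hSe : S e ≠ 0 := fun h => he.2 (by rw [← hSS e, h, map_zero])
  have hζ1 : ζ ≠ 1 := hζ.ne_one (by norm_num)
  have hζζ : ζ ≠ ζ⁻¹ := fun h => hζ.pow_ne_one_of_pos_of_lt (l := 2) (by norm_num) (by norm_num) <| by
    rw [pow_two]; nth_rw 2 [h]; exact mul_inv_cancel₀ hζ0
  have hli : LinearIndependent ℂ ![v, e, S e] := by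
    refine End.eigenvectors_linearIndependent' T ![1, ζ, ζ⁻¹] ?_ _ ?_
    · intro i j
      fin_cases i <;> fin_cases j <;> simp [hζ1, hζ1.symm, hζζ, hζζ.symm, eq_comm]
    · intro i
      fin_cases i
      · exact ⟨End.mem_eigenspace_iff.2 (by simpa using hTv'), hv⟩
      · exact he
      · exact ⟨End.mem_eigenspace_iff.2 hTSe, hSe⟩
  refine ⟨ζ, basisOfLinearIndependentOfCardEqFinrank hli (by simp [hV]), hζ, ?_⟩
  simp [hTv', hTe, hTSe, hSS]

/-- A vector fixed up to scalars by the reflection, but not proportional to the first basis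
vector, has nonzero second and third coordinates. -/
lemma coord_ne_zero_of_dihedral (β : Basis (Fin 3) ℂ V) {S : End ℂ V} {μ : ℂ}
    (h0 : S (β 0) = μ • β 0) (h1 : S (β 1) = β 2) (h2 : S (β 2) = β 1) {u : V} {ν a b c : ℂ}
    (hu : S u = ν • u) (hu' : u = a • β 0 + b • β 1 + c • β 2)
    (hne : u ≠ a • β 0) : b ≠ 0 ∧ c ≠ 0 := by
  have h := congrArg β.repr hu
  rw [hu'] at h
  have e1 : c = ν * b := by simpa [h0, h1, h2] using DFunLike.congr_fun h 1
  have e2 : b = ν * c := by simpa [h0, h1, h2] using DFunLike.congr_fun h 2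
  constructor <;> rintro rfl
  · exact hne (by simp [hu', e1])
  · exact hne (by simp [hu', e2])

lemma pow_apply_of_dihedral {β : Fin 3 → V} {T : End ℂ V} {ζ : ℂ} (h0 : T (β 0) = β 0)
    (h1 : T (β 1) = ζ • β 1) (h2 : T (β 2) = ζ⁻¹ • β 2) (a b c : ℂ) (n : ℕ) :
    (T ^ n) (a • β 0 + b • β 1 + c • β 2) =
      a • β 0 + (b * ζ ^ n) • β 1 + (c * (ζ ^ n)⁻¹) • β 2 := by
  have h0' : T (β 0) = (1 : ℂ) • β 0 := by rw [h0, one_smul]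
  simp only [map_add, map_smul, pow_apply_of_apply_eq_smul h0', pow_apply_of_apply_eq_smul h1,
    pow_apply_of_apply_eq_smul h2, one_pow, one_smul, smul_smul, inv_pow]

lemma linearIndependent_of_dihedral (β : Basis (Fin 3) ℂ V) {ζ : ℂ} (hζ : IsPrimitiveRoot ζ 5)
    {a b c : ℂ} (hb : b ≠ 0) (hc : c ≠ 0) {i j : Fin 5} (hij : i ≠ j) :
    LinearIndependent ℂ ![β 0, a • β 0 + (b * ζ ^ (i : ℕ)) • β 1 + (c * (ζ ^ (i : ℕ))⁻¹) • β 2,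
      a • β 0 + (b * ζ ^ (j : ℕ)) • β 1 + (c * (ζ ^ (j : ℕ))⁻¹) • β 2] := by
  have hζ0 : ζ ≠ 0 := hζ.ne_zero (by norm_num)
  have hsq : (ζ ^ (i : ℕ)) ^ 2 ≠ (ζ ^ (j : ℕ)) ^ 2 := by
    rw [← pow_mul', ← pow_mul', pow_mul, pow_mul]
    intro h
    exact hij (Fin.ext ((hζ.pow_of_coprime 2 (by norm_num)).pow_inj i.2 j.2 h))
  have hx : ζ ^ (i : ℕ) ≠ 0 := pow_ne_zero _ hζ0
  have hy : ζ ^ (j : ℕ) ≠ 0 := pow_ne_zero _ hζ0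
  generalize ζ ^ (i : ℕ) = x at *
  generalize ζ ^ (j : ℕ) = y at *
  rw [← LinearMap.linearIndependent_iff (β.equivFun : V →ₗ[ℂ] Fin 3 → ℂ) (by simp)]
  rw [show ⇑(β.equivFun : V →ₗ[ℂ] Fin 3 → ℂ) ∘ ![β 0, a • β 0 + (b * x) • β 1 + (c * x⁻¹) • β 2,
      a • β 0 + (b * y) • β 1 + (c * y⁻¹) • β 2] =
      (!![1, 0, 0; a, b * x, c * x⁻¹; a, b * y, c * y⁻¹] : Matrix (Fin 3) (Fin 3) ℂ).row by
    ext k l; fin_cases k <;> fin_cases l <;> simp]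
  rw [Matrix.linearIndependent_rows_iff_isUnit, Matrix.isUnit_iff_isUnit_det, isUnit_iff_ne_zero]
  simp only [Matrix.det_fin_three, Matrix.of_apply, Matrix.cons_val]
  intro h
  field_simp at h
  refine hsq (mul_left_cancel₀ hb (mul_left_cancel₀ hc ?_))
  linear_combination h

lemma not_linearIndependent_of_dihedral {β : Fin 3 → V} {ζ : ℂ} (hζ0 : ζ ≠ 0) (b c : ℂ) :
    ¬ LinearIndependent ℂ ![b • β 1 + c • β 2, (b * ζ) • β 1 + (c * ζ⁻¹) • β 2,
      (b * ζ ^ 2) • β 1 + (c * (ζ ^ 2)⁻¹) • β 2] := by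
  rw [Fintype.not_linearIndependent_iff]
  refine ⟨![1, -(ζ + ζ⁻¹), 1], ?_, 0, by simp⟩
  simp only [Fin.sum_univ_three, Matrix.cons_val]
  match_scalars <;> field_simp <;> ring

/-- A quadratic form vanishing at the first basis vector and at the orbit of a vector with nonzero
coordinates vanishes. -/
lemma quadraticForm_eq_zero_of_dihedral (β : Basis (Fin 3) ℂ V) {ζ : ℂ} (hζ : IsPrimitiveRoot ζ 5)
    {a b c : ℂ} (ha : a ≠ 0) (hb : b ≠ 0) (hc : c ≠ 0) {Q : QuadraticForm ℂ V} (hQ0 : Q (β 0) = 0)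
    (hQ : ∀ i : Fin 5,
      Q (a • β 0 + (b * ζ ^ (i : ℕ)) • β 1 + (c * (ζ ^ (i : ℕ))⁻¹) • β 2) = 0) : Q = 0 := by
  have hζ0 : ζ ≠ 0 := hζ.ne_zero (by norm_num)
  have hexp (x y z : ℂ) : Q (x • β 0 + y • β 1 + z • β 2) =
      y ^ 2 * Q (β 1) + z ^ 2 * Q (β 2) + x * y * QuadraticMap.polar Q (β 0) (β 1) +
      x * z * QuadraticMap.polar Q (β 0) (β 2) + y * z * QuadraticMap.polar Q (β 1) (β 2) := by
    rw [QuadraticMap.map_add Q, QuadraticMap.map_add Q]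
    simp only [QuadraticMap.map_smul, hQ0, QuadraticMap.polar_add_left,
      QuadraticMap.polar_smul_left, QuadraticMap.polar_smul_right, smul_eq_mul]
    ring
  have hinj : Function.Injective fun i : Fin 5 => ζ ^ (i : ℕ) :=
    fun i j h => Fin.ext (hζ.pow_inj i.2 j.2 h)
  have hzero := Matrix.eq_zero_of_forall_index_sum_pow_mul_eq_zero hinj (v :=
    ![c ^ 2 * Q (β 2), a * c * QuadraticMap.polar Q (β 0) (β 2),
      b * c * QuadraticMap.polar Q (β 1) (β 2), a * b * QuadraticMap.polar Q (β 0) (β 1),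
      b ^ 2 * Q (β 1)]) fun i => by
    have hi := hQ i
    rw [hexp] at hi
    have hx : ζ ^ (i : ℕ) ≠ 0 := pow_ne_zero _ hζ0
    simp only [Fin.sum_univ_five, Matrix.cons_val, Fin.coe_ofNat_eq_mod]
    generalize ζ ^ (i : ℕ) = x at *
    field_simp at hi
    norm_num
    linear_combination hi
  have h0 := congrFun hzero 0
  have h1 := congrFun hzero 1
  have h2 := congrFun hzero 2
  have h3 := congrFun hzero 3
  have h4 := congrFun hzero 4
  simp [ha, hb, hc] at h0 h1 h2 h3 h4
  ext x
  rw [← β.sum_repr x, Fin.sum_univ_three, hexp, h0, h1, h2, h3, h4]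
  simp

end Dihedral

section Projective

open Module
open scoped LinearAlgebra.Projectivization

lemma Projectivization.Independent.smul {G K V ι : Type*} [Field K] [AddCommGroup V] [Module K V]
    [Group G] [DistribMulAction G V] [SMulCommClass G K V] {P : ι → ℙ K V}
    (hP : Projectivization.Independent P) (g : G) :
    Projectivization.Independent fun i => g • P i := by
  obtain ⟨f, hf, hl⟩ := hP
  exact .mk (fun i => g • f i) (fun i => (smul_ne_zero_iff_ne g).2 (hf i))
    (hl.map' (DistribSMul.toLinearMap K V g)
      (LinearMap.ker_eq_bot.2 (MulAction.injective g)))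

lemma Projectivization.independent_mk_iff {K V ι : Type*} [Field K] [AddCommGroup V] [Module K V]
    {f : ι → V} {hf : ∀ i, f i ≠ 0} :
    Projectivization.Independent (fun i => Projectivization.mk K (f i) (hf i)) ↔
      LinearIndependent K f := by
  refine ⟨fun h => ?_, .mk f hf⟩
  contrapose! h
  exact Projectivization.dependent_iff_not_independent.1 (.mk f hf h)

lemma Projectivization.map_submodule_smul {G K V : Type*} [Field K] [AddCommGroup V] [Module K V]
    [Group G] [DistribMulAction G V] [SMulCommClass G K V] (g : G) (x : ℙ K V) :
    x.submodule.map (DistribSMul.toLinearMap K V g) = (g • x).submodule := by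
  induction x with
  | h v hv => simp [Projectivization.smul_mk, Submodule.map_span]

lemma Projectivization.exists_smul_rep_eq_of_smul_eq {G K V : Type*} [Field K] [AddCommGroup V]
    [Module K V] [Group G] [DistribMulAction G V] [SMulCommClass G K V] {g : G} {x : ℙ K V}
    (h : g • x = x) : ∃ c : K, g • x.rep = c • x.rep := by
  conv_lhs at h => rw [← x.mk_rep]
  conv_rhs at h => rw [← x.mk_rep]
  rw [Projectivization.smul_mk, Projectivization.mk_eq_mk_iff'] at h
  obtain ⟨c, hc⟩ := h
  exact ⟨c, hc.symm⟩

lemma QuadraticMap.apply_rep_eq_zero_iff {K V : Type*} [Field K] [AddCommGroup V] [Module K V]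
    (Q : QuadraticForm K V) {v : V} (hv : v ≠ 0) :
    Q (Projectivization.mk K v hv).rep = 0 ↔ Q v = 0 := by
  obtain ⟨c, hc⟩ := Projectivization.exists_smul_eq_mk_rep K v hv
  rw [← hc, Units.smul_def, QuadraticMap.map_smul]
  simp

variable {V : Type*} [AddCommGroup V] [Module ℂ V] [DistribMulAction (alternatingGroup (Fin 5)) V]
  [SMulCommClass (alternatingGroup (Fin 5)) ℂ V] [FaithfulSMul (alternatingGroup (Fin 5)) V]

/-- Coordinates for a six-point orbit of `A₅` on the projective plane. -/
lemma exists_basis_of_ncard_orbit_eq_six (hV : finrank ℂ V = 3) {p : ℙ ℂ V}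
    (hp : (orbit (alternatingGroup (Fin 5)) p).ncard = 6) :
    ∃ (t : alternatingGroup (Fin 5)) (w : ℙ ℂ V) (β : Basis (Fin 3) ℂ V) (ζ a b c : ℂ),
      IsPrimitiveRoot ζ 5 ∧ b ≠ 0 ∧ c ≠ 0 ∧ t ^ 5 = 1 ∧ t • p = p ∧ t • w ≠ w ∧
      orbit (alternatingGroup (Fin 5)) p =
        insert p (Set.range fun i : Fin 5 => t ^ (i : ℕ) • w) ∧
      p.rep = β 0 ∧ ∀ n : ℕ, t ^ n • w.rep =
        a • β 0 + (b * ζ ^ n) • β 1 + (c * (ζ ^ n)⁻¹) • β 2 := by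
  obtain ⟨t, s, w, ht1, ht5, hs, hst, htp, hsp, hsw, htw, horb⟩ := exists_dihedral_orbit hp
  obtain ⟨c, hc⟩ := Projectivization.exists_smul_rep_eq_of_smul_eq htp
  obtain ⟨μ, hμ⟩ := Projectivization.exists_smul_rep_eq_of_smul_eq hsp
  obtain ⟨ν, hν⟩ := Projectivization.exists_smul_rep_eq_of_smul_eq hsw
  let φ := DistribMulAction.toModuleEnd ℂ V (S := alternatingGroup (Fin 5))
  have hφ (g) (x : V) : φ g x = g • x := rfl
  have hT1 : φ t ≠ 1 := fun h => ht1 <| eq_of_smul_eq_smul fun x : V => by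
    rw [← hφ, h, one_smul, End.one_apply]
  obtain ⟨ζ, β, hζ, hβ, h0, h1, h2, hS1, hS2⟩ := exists_dihedral_basis hV hT1
    (by rw [← map_pow, ht5, map_one]) (by rw [← map_pow, hs, map_one] : φ s ^ 2 = 1)
    (by rw [← map_mul, ← map_mul, mul_assoc, hst, mul_inv_cancel_left]) p.rep_nonzero hc hμ
  have hw : w.rep = β.repr w.rep 0 • β 0 + β.repr w.rep 1 • β 1 + β.repr w.rep 2 • β 2 := by
    rw [← Fin.sum_univ_three fun i => β.repr w.rep i • β i, β.sum_repr]
  obtain ⟨hb, hc⟩ := coord_ne_zero_of_dihedral β (hβ ▸ hμ : φ s (β 0) = _) hS1 hS2 hν hw fun h => by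
    refine htw ?_
    rw [show w = p by
      rw [← w.mk_rep, ← p.mk_rep, Projectivization.mk_eq_mk_iff']
      exact ⟨_, (hβ ▸ h).symm⟩, htp]
  refine ⟨t, w, β, ζ, β.repr w.rep 0, _, _, hζ, hb, hc, ht5, htp, htw, horb, hβ.symm, fun n => ?_⟩
  rw [← pow_apply_of_dihedral h0 h1 h2, ← hw, ← map_pow, hφ]

/-- No three points of a six-point orbit of `A₅` on the projective plane are collinear. -/
theorem independent_of_ncard_orbit_eq_six (hV : finrank ℂ V = 3) {p : ℙ ℂ V}
    (hp : (orbit (alternatingGroup (Fin 5)) p).ncard = 6) {x y z : ℙ ℂ V}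
    (hx : x ∈ orbit (alternatingGroup (Fin 5)) p) (hy : y ∈ orbit (alternatingGroup (Fin 5)) p)
    (hz : z ∈ orbit (alternatingGroup (Fin 5)) p) (hxy : x ≠ y) (hxz : x ≠ z) (hyz : y ≠ z) :
    Projectivization.Independent ![x, y, z] := by
  obtain ⟨t, w, β, ζ, a, b, c, hζ, hb, hc, -, -, -, horb, hβ, hw⟩ :=
    exists_basis_of_ncard_orbit_eq_six hV hp
  obtain ⟨g, rfl⟩ := hx
  have hmem {y : ℙ ℂ V} (hy : y ∈ orbit (alternatingGroup (Fin 5)) p) (hne : g • p ≠ y) :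
      ∃ i : Fin 5, t ^ (i : ℕ) • w = g⁻¹ • y := by
    have : g⁻¹ • y ∈ orbit (alternatingGroup (Fin 5)) p := mem_orbit_of_mem_orbit _ hy
    rw [horb] at this
    exact this.resolve_left fun h => hne (inv_smul_eq_iff.1 h).symm
  obtain ⟨i, hi⟩ := hmem hy hxy
  obtain ⟨j, hj⟩ := hmem hz hxz
  have hij : i ≠ j := by
    rintro rfl
    exact hyz (smul_left_cancel _ (hi.symm.trans hj))
  have h := linearIndependent_of_dihedral β hζ hb hc (a := a) hij
  rw [← hw, ← hw, ← hβ] at h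
  convert (Projectivization.Independent.mk _ (fun k => h.ne_zero k) h).smul g using 1
  ext k
  rw [eq_inv_smul_iff] at hi hj
  fin_cases k
  · simp
  · simp [← hi, ← Projectivization.smul_mk _ w.rep_nonzero]
  · simp [← hj, ← Projectivization.smul_mk _ w.rep_nonzero]

/-- A six-point orbit of `A₅` on the projective plane does not lie on a conic. -/
theorem quadraticForm_eq_zero_of_ncard_orbit_eq_six (hV : finrank ℂ V = 3) {p : ℙ ℂ V}
    (hp : (orbit (alternatingGroup (Fin 5)) p).ncard = 6) {Q : QuadraticForm ℂ V}
    (hQ : ∀ x ∈ orbit (alternatingGroup (Fin 5)) p, Q x.rep = 0) : Q = 0 := by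
  obtain ⟨t, w, β, ζ, a, b, c, hζ, hb, hc, ht5, htp, htw, horb, hβ, hw⟩ :=
    exists_basis_of_ncard_orbit_eq_six hV hp
  have : Fact (Nat.Prime 5) := ⟨by norm_num⟩
  have hinj := pow_smul_injective_of_prime ht5 htw
  have hmem (i : Fin 5) : t ^ (i : ℕ) • w ∈ orbit (alternatingGroup (Fin 5)) p := by
    rw [horb]
    exact Or.inr ⟨i, rfl⟩
  have hmk (g : alternatingGroup (Fin 5)) : g • w =
      Projectivization.mk ℂ (g • w.rep) ((smul_ne_zero_iff_ne g).2 w.rep_nonzero) := by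
    conv_lhs => rw [← w.mk_rep, Projectivization.smul_mk]
  have ha : a ≠ 0 := by
    rintro rfl
    have h := independent_of_ncard_orbit_eq_six hV hp (hmem 0) (hmem 1) (hmem 2)
      (hinj.ne (by decide)) (hinj.ne (by decide)) (hinj.ne (by decide))
    rw [show ![t ^ ((0 : Fin 5) : ℕ) • w, t ^ ((1 : Fin 5) : ℕ) • w, t ^ ((2 : Fin 5) : ℕ) • w] =
      fun k : Fin 3 => Projectivization.mk ℂ (t ^ (k : ℕ) • w.rep)
        ((smul_ne_zero_iff_ne _).2 w.rep_nonzero) by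
      ext k
      rw [← hmk]
      fin_cases k <;> rfl] at h
    refine not_linearIndependent_of_dihedral (β := β) (hζ.ne_zero (by norm_num)) b c ?_
    rw [show ![b • β 1 + c • β 2, (b * ζ) • β 1 + (c * ζ⁻¹) • β 2,
        (b * ζ ^ 2) • β 1 + (c * (ζ ^ 2)⁻¹) • β 2] = fun k : Fin 3 => t ^ (k : ℕ) • w.rep by
      ext k
      rw [hw]
      fin_cases k <;> simp]
    exact Projectivization.independent_mk_iff.1 h
  refine quadraticForm_eq_zero_of_dihedral β hζ ha hb hc ?_ fun i => ?_
  · rw [← hβ]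
    exact hQ p (mem_orbit_self p)
  · rw [← hw, ← QuadraticMap.apply_rep_eq_zero_iff Q ((smul_ne_zero_iff_ne _).2 w.rep_nonzero),
      ← hmk]
    exact hQ _ (hmem i)

/-- `A₅` permutes transitively the lines through two points of a six-point orbit. -/
theorem exists_map_span_eq_of_ncard_orbit_eq_six (hV : finrank ℂ V = 3) {p : ℙ ℂ V}
    (hp : (orbit (alternatingGroup (Fin 5)) p).ncard = 6) {x y x' y' : ℙ ℂ V}
    (hx : x ∈ orbit (alternatingGroup (Fin 5)) p) (hy : y ∈ orbit (alternatingGroup (Fin 5)) p)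
    (hx' : x' ∈ orbit (alternatingGroup (Fin 5)) p) (hy' : y' ∈ orbit (alternatingGroup (Fin 5)) p)
    (hxy : x ≠ y) (hxy' : x' ≠ y') : ∃ g : alternatingGroup (Fin 5),
      (Submodule.span ℂ {x.rep, y.rep}).map (DistribSMul.toLinearMap ℂ V g) =
        Submodule.span ℂ {x'.rep, y'.rep} := by
  obtain ⟨t, w, β, ζ, a, b, c, -, -, -, -, htp, -, horb, -⟩ :=
    exists_basis_of_ncard_orbit_eq_six hV hp
  obtain ⟨g, hgx, hgy⟩ := exists_smul_eq_and_smul_eq htp horb hx hy hxy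
  obtain ⟨h, hhx, hhy⟩ := exists_smul_eq_and_smul_eq htp horb hx' hy' hxy'
  refine ⟨h⁻¹ * g, ?_⟩
  rw [Submodule.span_insert, Submodule.span_insert, ← Projectivization.submodule_eq,
    ← Projectivization.submodule_eq, ← Projectivization.submodule_eq,
    ← Projectivization.submodule_eq, Submodule.map_sup, Projectivization.map_submodule_smul,
    Projectivization.map_submodule_smul, mul_smul, mul_smul, hgx, hgy, ← hhx, ← hhy,
    inv_smul_smul, inv_smul_smul]

end Projective

end ActionOfA5

/-- if `ρ : A₅ → GL(3,ℂ)` is an injective group homomorphism, `G = ρ(A₅)`,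
and `Ω` is the unique `G`-orbit on `ℙ²` with exactly 6 elements, then (i) no three distinct
points of `Ω` are collinear; (ii) `Ω` does not lie on a conic; (iii) `G` acts transitively
on the lines through pairs of points of `Ω`. -/
theorem statement15 (ρ : ↥(alternatingGroup (Fin 5)) →* GL3) (hρ : Function.Injective ρ)
    (Ω : Set P2) (hΩorb : ∃ p : P2, Ω = projOrbit (matSetGL ρ.range) p)
    (hΩ6 : Ω.encard = 6) :
    NoThreeCollinear Ω ∧
    ¬ LiesOnConic Ω ∧
    (∀ p q p' q' : P2, p ∈ Ω → q ∈ Ω → p' ∈ Ω → q' ∈ Ω → p ≠ q → p' ≠ q' →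
      ∃ g ∈ matSetGL ρ.range,
        Submodule.map (Matrix.mulVecLin g)
            (Submodule.span ℂ {Projectivization.rep p, Projectivization.rep q}) =
          Submodule.span ℂ {Projectivization.rep p', Projectivization.rep q'}) := by
  let A := alternatingGroup (Fin 5)
  let φ : A →* Module.End ℂ (Fin 3 → ℂ) :=
    (Matrix.toLinAlgEquiv' : M3 ≃ₐ[ℂ] _).toMonoidHom.comp ((Units.coeHom M3).comp ρ)
  let _ : DistribMulAction A (Fin 3 → ℂ) := DistribMulAction.compHom _ φ
  have hsmul (g : A) (x : Fin 3 → ℂ) : g • x = (ρ g : M3).mulVec x := rfl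
  have : SMulCommClass A ℂ (Fin 3 → ℂ) := ⟨fun g c x => by simp only [hsmul, mulVec_smul]⟩
  have : FaithfulSMul A (Fin 3 → ℂ) := ⟨fun {g h} hgh => hρ <| Units.ext <| by
    refine Matrix.mulVec_injective (funext fun x => ?_)
    exact hgh x⟩
  have hmem (g : A) : (ρ g : M3) ∈ matSetGL ρ.range := ⟨ρ g, ⟨g, rfl⟩, rfl⟩
  have horbit (p : P2) : projOrbit (matSetGL ρ.range) p = MulAction.orbit A p := by
    have hmk (g : A) : g • p = Projectivization.mk ℂ (g • p.rep)
        ((smul_ne_zero_iff_ne g).2 p.rep_nonzero) := by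
      conv_lhs => rw [← p.mk_rep, Projectivization.smul_mk]
    ext q
    constructor
    · rintro ⟨_, ⟨_, ⟨g, rfl⟩, rfl⟩, h, rfl⟩
      exact ⟨g, hmk g⟩
    · rintro ⟨g, rfl⟩
      exact ⟨_, hmem g, _, (hmk g).symm⟩
  obtain ⟨p, rfl⟩ := hΩorb
  rw [horbit] at hΩ6 ⊢
  have hcard : (MulAction.orbit A p).ncard = 6 := by rw [Set.ncard, hΩ6]; rfl
  have hV : Module.finrank ℂ (Fin 3 → ℂ) = 3 := by simp
  refine ⟨fun x y z hx hy hz hxy hxz hyz => ?_, ?_, fun x y x' y' hx hy hx' hy' hxy hxy' => ?_⟩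
  · have h := Projectivization.independent_iff.1
      (independent_of_ncard_orbit_eq_six hV hcard hx hy hz hxy hxz hyz)
    rw [show Projectivization.rep ∘ ![x, y, z] = ![x.rep, y.rep, z.rep] by
      ext k
      fin_cases k <;> rfl] at h
    exact h
  · rintro ⟨Q, hQ, h⟩
    exact hQ (quadraticForm_eq_zero_of_ncard_orbit_eq_six hV hcard h)
  · obtain ⟨g, hg⟩ :=
      exists_map_span_eq_of_ncard_orbit_eq_six hV hcard hx hy hx' hy' hxy hxy'
    exact ⟨_, hmem g, hg⟩
end
end

section
/- Let ρ : PSL(2,𝔽₇) → GL(3,ℂ) be an injective group homomorphism, where PSL(2,𝔽₇) is the projective special linear group of 2×2 matrices over the field with 7 elements (the simple group of order 168). Then every orbit of the group ρ(PSL(2,𝔽₇)) acting on ℙ² has more than 8 elements. -/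
open Matrix Complex

noncomputable section

/-- `PSL(2,𝔽₇) = SL(2,𝔽₇)` modulo its center. -/
abbrev PSL27 : Type := Matrix.ProjectiveSpecialLinearGroup (Fin 2) (ZMod 7)

/-- The group `SL(2,𝔽₇)`. -/
abbrev SL27 : Type := Matrix.SpecialLinearGroup (Fin 2) (ZMod 7)

namespace SL27

/-- The upper unipotent generator. -/
def T : SL27 := ⟨!![1, 1; 0, 1], by decide⟩

/-- The lower unipotent generator. -/
def U : SL27 := ⟨!![1, 0; 1, 1], by decide⟩

/-- A diagonal element of order 3. -/
def S : SL27 := ⟨!![4, 0; 0, 2], by decide⟩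

/-- The Weyl element. -/
def w : SL27 := ⟨!![0, -1; 1, 0], by decide⟩

lemma T_pow_seven : T ^ 7 = 1 := by decide

lemma U_pow_seven : U ^ 7 = 1 := by decide

lemma S_mul_T : S * T = T ^ 2 * S := by decide

lemma S_eq_word : S = T * U * T * U ^ 3 * T := by decide

lemma w_mul_U : w * U ^ 6 = T * w := by decide

end SL27

/-- If an element `t` of order dividing 7 preserves `X` and moves a point `q` of `X`, and `X` has
two further points outside the `t`-orbit of `q`, then `X` has more than 8 elements. -/
lemma eight_lt_encard_of_pow_seven {G α : Type*} [Group G] [MulAction G α] {X : Set α} {t : G}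
    (ht : t ^ 7 = 1) (hX : ∀ x ∈ X, t • x ∈ X) {q r r' : α} (hq : q ∈ X) (hr : r ∈ X)
    (hr' : r' ∈ X) (htq : t • q ≠ q) (hrr' : r ≠ r') (h : ∀ i : ℕ, t ^ i • q ≠ r)
    (h' : ∀ i : ℕ, t ^ i • q ≠ r') : 8 < X.encard := by
  classical
  have hper : MulAction.period t q = 7 := by
    refine ((Nat.dvd_prime (by norm_num)).1
      (MulAction.pow_smul_eq_iff_period_dvd.1 (by rw [ht, one_smul]))).resolve_left fun h1 ↦ htq ?_
    simpa [h1] using MulAction.pow_period_smul t q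
  have hmem : ∀ i : ℕ, t ^ i • q ∈ X := by
    intro i
    induction i with
    | zero => simpa using hq
    | succ n ih => rw [pow_succ', mul_smul]; exact hX _ ih
  have hle : ∀ i j : ℕ, i ≤ j → j < 7 → t ^ i • q = t ^ j • q → i = j := by
    intro i j hij hj e
    have h0 : t ^ (j - i) • q = q := by
      rw [← smul_left_cancel_iff (t ^ i), ← mul_smul, ← pow_add, Nat.add_sub_cancel' hij, e]
    have := MulAction.pow_smul_eq_iff_period_dvd.1 h0
    rw [hper] at this
    omega
  have hinj : Set.InjOn (fun i : ℕ ↦ t ^ i • q) (Finset.range 7 : Finset ℕ) := by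
    intro i hi j hj e
    simp only [Finset.coe_range, Set.mem_Iio] at hi hj
    rcases le_total i j with hij | hij
    · exact hle i j hij hj e
    · exact (hle j i hij hi e.symm).symm
  set F : Finset α := insert r (insert r' ((Finset.range 7).image fun i ↦ t ^ i • q)) with hF
  have hcard : F.card = 9 := by
    rw [hF, Finset.card_insert_of_notMem, Finset.card_insert_of_notMem,
      Finset.card_image_of_injOn hinj, Finset.card_range]
    · simpa using fun i _ ↦ h' i
    · simpa [hrr'] using fun i _ ↦ h i
  have hsub : (F : Set α) ⊆ X := by
    intro x hx
    simp only [hF, Finset.coe_insert, Finset.coe_image, Set.mem_insert_iff, Set.mem_image] at hx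
    rcases hx with rfl | rfl | ⟨i, -, rfl⟩
    exacts [hr, hr', hmem i]
  calc (8 : ℕ∞) < 9 := by norm_num
    _ = (F : Set α).encard := by rw [Set.encard_coe_eq_coe_finsetCard, hcard]; rfl
    _ ≤ X.encard := Set.encard_le_encard hsub

namespace SL27

open MulAction

variable {α : Type*} [MulAction SL27 α]

lemma eight_lt_encard_orbit_of_T_fixed (hTS : ∀ q : α, T • q = q → S • q ≠ q) {q : α}
    (hq : T • q = q) : 8 < (orbit SL27 q).encard := by
  have hSq : T • S • q = S • q := by
    have h3 : T * S = S * T ^ 4 := by decide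
    rw [← mul_smul, h3, mul_smul]
    congr 1
    simp [pow_succ, mul_smul, hq]
  have hw : T • w • q ≠ w • q := by
    intro h
    rw [← mul_smul, ← w_mul_U, mul_smul, smul_left_cancel_iff] at h
    have hU : U • q = q := by
      nth_rw 1 [← h]
      rw [← mul_smul, ← pow_succ', U_pow_seven, one_smul]
    refine hTS q hq ?_
    rw [S_eq_word]
    simp [pow_succ, mul_smul, hq, hU]
  have key : ∀ r : α, T • r = r → ∀ i : ℕ, T ^ i • w • q ≠ r := by
    intro r hr i h
    apply hw
    have hi : T ^ i • r = r := (stabilizer SL27 r).pow_mem hr i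
    rw [← hi, smul_left_cancel_iff] at h
    rw [h, hr]
  exact eight_lt_encard_of_pow_seven T_pow_seven (fun x hx ↦ mem_orbit_of_mem_orbit T hx)
    (mem_orbit q w) (mem_orbit_self q) (mem_orbit q S) hw (hTS q hq).symm (key q hq) (key _ hSq)

/-- An element with a power conjugate to `T` fixes no point of an orbit on which `T` has no fixed
points. -/
lemma notMem_stabilizer_of_pow_mul {q : α} (hT : ∀ r ∈ orbit SL27 q, T • r ≠ r) {u : SL27}
    (n : ℕ) (c : SL27) (h : u ^ n * c = c * T) : u ∉ stabilizer SL27 q := by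
  intro hu
  have h1 : (u ^ n) • q = q := (stabilizer SL27 q).pow_mem hu n
  refine hT (c⁻¹ • q) (mem_orbit q _) ?_
  rw [← mul_smul, eq_inv_smul_iff, ← mul_smul, ← mul_assoc, ← h, mul_inv_cancel_right, h1]

/-- On an orbit of size at most 8 without `T`-fixed points, `T` acts transitively. -/
lemma exists_pow_mul_mem_stabilizer {q : α} (hT : ∀ r ∈ orbit SL27 q, T • r ≠ r)
    (hq : (orbit SL27 q).encard ≤ 8) (g : SL27) :
    ∃ i < 7, T ^ i * g ∈ stabilizer SL27 q := by
  by_contra! H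
  have key : ∀ i : ℕ, T ^ i * g ∉ stabilizer SL27 q := by
    intro i hi
    refine H (i % 7) (Nat.mod_lt _ (by norm_num)) ?_
    rwa [← pow_eq_pow_mod i T_pow_seven]
  have key' : ∀ i k : ℕ, T ^ i • q ≠ T ^ k • g • q := by
    intro i k h
    refine key (6 * i + k) ?_
    rw [mem_stabilizer_iff, pow_add, mul_assoc, mul_smul, mul_smul, ← h, ← mul_smul, ← pow_add,
      show 6 * i + i = 7 * i by ring, pow_mul, T_pow_seven, one_pow, one_smul]
  refine absurd hq (not_le.2 (eight_lt_encard_of_pow_seven T_pow_seven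
    (fun x hx ↦ mem_orbit_of_mem_orbit T hx) (mem_orbit_self q) (mem_orbit q g)
    (mem_orbit_of_mem_orbit T (mem_orbit q g)) (hT q (mem_orbit_self q))
    (hT _ (mem_orbit q g)).symm (fun i ↦ ?_) fun i ↦ ?_))
  · simpa using key' i 0
  · simpa using key' i 1

/-- On an orbit of size at most 8 without `T`-fixed points, some point is fixed by a subgroup
covering an octahedral subgroup of `PSL(2,𝔽₇)`. -/
lemma exists_fixed_of_encard_orbit_le {p : α} (hT : ∀ r ∈ orbit SL27 p, T • r ≠ r)
    (hp : (orbit SL27 p).encard ≤ 8) :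
    ∃ q : α, S • q = q ∧ w • q = q ∧ ((T ^ 2 * U) • q = q ∨ (T ^ 4 * U) • q = q) := by
  obtain ⟨i, -, hi⟩ := exists_pow_mul_mem_stabilizer hT hp S
  rw [mem_stabilizer_iff, mul_smul] at hi
  have hST : ∀ i : ℕ, S * T ^ i = T ^ i * (T ^ i * S) := by
    intro i
    induction i with
    | zero => simp
    | succ n ih =>
      rw [pow_succ, ← mul_assoc, ih, mul_assoc, mul_assoc, S_mul_T]
      simp only [← mul_assoc, ← pow_add, ← pow_succ]
      congr 2
      ring
  obtain ⟨q, hqp, hS⟩ : ∃ q ∈ orbit SL27 p, S • q = q := by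
    refine ⟨T ^ i • p, mem_orbit p _, ?_⟩
    rw [← mul_smul, hST, mul_smul, mul_smul, hi]
  rw [← orbit_eq_iff.2 hqp] at hT hp
  have bad : ∀ {u : SL27} (n : ℕ) (c : SL27), u ^ n * c = c * T → u ∉ stabilizer SL27 q :=
    notMem_stabilizer_of_pow_mul hT
  have mul {a b : SL27} (ha : a ∈ stabilizer SL27 q) (hb : b ∈ stabilizer SL27 q) :
    a * b ∈ stabilizer SL27 q := mul_mem ha hb
  replace hS : S ∈ stabilizer SL27 q := hS
  have hw : w ∈ stabilizer SL27 q := by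
    obtain ⟨i, hi, h⟩ := exists_pow_mul_mem_stabilizer hT hp w
    interval_cases i
    · simpa using h
    · exact absurd (mul hS (mul hS h)) (bad 3 ⟨!![1, 0; 4, 1], by decide⟩ (by decide))
    · exact absurd h (bad 3 ⟨!![2, 0; 2, 4], by decide⟩ (by decide))
    · exact absurd (mul hS h) (bad 2 ⟨!![1, 0; 5, 1], by decide⟩ (by decide))
    · exact absurd (mul hS h) (bad 3 ⟨!![3, 0; 6, 5], by decide⟩ (by decide))
    · exact absurd h (bad 2 ⟨!![3, 0; 4, 5], by decide⟩ (by decide))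
    · exact absurd (mul hS (mul hS h)) (bad 2 ⟨!![2, 0; 6, 4], by decide⟩ (by decide))
  refine ⟨q, hS, hw, ?_⟩
  obtain ⟨i, hi, h⟩ := exists_pow_mul_mem_stabilizer hT hp U
  interval_cases i
  · exact absurd h (bad 3 ⟨!![0, 3; 2, 0], by decide⟩ (by decide))
  · exact absurd (mul hS (mul hw h)) (bad 2 ⟨!![1, 0; 1, 1], by decide⟩ (by decide))
  · exact Or.inl h
  · exact absurd h (bad 2 ⟨!![1, 0; 3, 1], by decide⟩ (by decide))
  · exact Or.inr h
  · exact absurd (mul hS h) (bad 2 ⟨!![3, 0; 5, 5], by decide⟩ (by decide))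
  · exact absurd (mul hw h) (bad 2 ⟨!![3, 0; 0, 5], by decide⟩ (by decide))

/-- An action of `SL(2,𝔽₇)` in which no point is fixed by the Borel subgroup `⟨T, S⟩`, nor by either
of two subgroups covering octahedral subgroups of `PSL(2,𝔽₇)`, has only orbits of size at least 9. -/
theorem eight_lt_encard_orbit (hTS : ∀ q : α, T • q = q → S • q ≠ q)
    (h₂ : ∀ q : α, S • q = q → (w * (T ^ 2 * U)) • q ≠ q)
    (h₄ : ∀ q : α, S • q = q → (T ^ 4 * U) • q ≠ q) (p : α) : 8 < (orbit SL27 p).encard := by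
  by_contra! hp
  have hT : ∀ r ∈ orbit SL27 p, T • r ≠ r := fun r hr hTr ↦
    (eight_lt_encard_orbit_of_T_fixed hTS hTr).not_ge (by rwa [orbit_eq_iff.2 hr])
  obtain ⟨q, hS, hw, h | h⟩ := exists_fixed_of_encard_orbit_le hT hp
  · exact h₂ q hS (by rw [mul_smul, h, hw])
  · exact h₄ q hS h

end SL27

section LinearAlgebra

open Polynomial in
/-- A nontrivial endomorphism `A` with `A ^ 7 = 1` has an eigenvalue different from 1. -/
lemma Module.End.exists_apply_eq_smul_of_pow_seven {V : Type*} [AddCommGroup V] [Module ℂ V]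
    {A : Module.End ℂ V} (h7 : A ^ 7 = 1) (h1 : A ≠ 1) :
    ∃ ζ : ℂ, ζ ^ 7 = 1 ∧ ζ ≠ 1 ∧ ∃ u : V, u ≠ 0 ∧ A u = ζ • u := by
  by_contra! H
  have hinj : ∀ s : Finset ℂ, (∀ ζ ∈ s, ζ ^ 7 = 1 ∧ ζ ≠ 1) → ∀ u : V,
      aeval A (∏ ζ ∈ s, (X - C ζ)) u = 0 → u = 0 := by
    intro s
    induction s using Finset.induction_on with
    | empty => intro _ u hu; simpa using hu
    | insert ζ s hζ ih =>
      intro hs u hu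
      rw [Finset.prod_insert hζ, mul_comm, map_mul, Module.End.mul_apply] at hu
      have hu' := ih (fun ξ hξ ↦ hs ξ (Finset.mem_insert_of_mem hξ)) _ hu
      obtain ⟨hζ7, hζ1⟩ := hs ζ (Finset.mem_insert_self ζ s)
      by_contra hu0
      refine H ζ hζ7 hζ1 u hu0 ?_
      simpa [sub_eq_zero] using hu'
  have hprod := X_pow_sub_one_eq_prod (R := ℂ) (by norm_num)
    (Complex.isPrimitiveRoot_exp 7 (by norm_num))
  have h1mem : (1 : ℂ) ∈ nthRootsFinset 7 (1 : ℂ) := by simp [mem_nthRootsFinset]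
  rw [← Finset.prod_erase_mul _ _ h1mem] at hprod
  apply h1
  ext u
  have hu := congrArg (fun P ↦ aeval A P u) hprod
  simp only [map_mul, Module.End.mul_apply] at hu
  have := hinj _ (fun ζ hζ ↦ ?_) _ (hu.symm.trans (by simp [h7]))
  · simpa [sub_eq_zero] using this
  · rw [Finset.mem_erase, mem_nthRootsFinset (by norm_num)] at hζ
    exact hζ.symm

/-- A pair of endomorphisms of a space of dimension 3 generating a nonabelian group of order 21
has no common eigenvector. -/
lemma not_common_eigenvector_of_mul_eq_sq_mul {V : Type*} [AddCommGroup V] [Module ℂ V]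
    [FiniteDimensional ℂ V] (hV : Module.finrank ℂ V = 3) {A B : Module.End ℂ V}
    (h7 : A ^ 7 = 1) (h1 : A ≠ 1) (hB : Function.Injective B) (hAB : B * A = A ^ 2 * B)
    {v : V} (hv : v ≠ 0) {a b : ℂ} (hAv : A v = a • v) (hBv : B v = b • v) : False := by
  have hb : b ≠ 0 := by
    rintro rfl
    exact hv (hB (by rw [hBv, zero_smul, map_zero]))
  have hBA (u : V) : B (A u) = A (A (B u)) := by
    simpa [pow_two] using LinearMap.congr_fun hAB u
  have ha0 : a ≠ 0 := by
    rintro rfl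
    have := LinearMap.congr_fun h7 v
    rw [pow_succ, Module.End.mul_apply, hAv, zero_smul, map_zero] at this
    exact hv this.symm
  have ha : a = 1 := by
    have h := hBA v
    simp only [hAv, hBv, map_smul, smul_smul] at h
    have h' := smul_left_injective ℂ hv h
    field_simp at h'
    exact h'.symm
  subst ha
  obtain ⟨ζ, hζ7, hζ1, u, hu, hAu⟩ := Module.End.exists_apply_eq_smul_of_pow_seven h7 h1
  have step {u : V} {ζ : ℂ} (hAu : A u = ζ • u) : A (B u) = ζ ^ 4 • B u := by
    have h2 : A (A (B u)) = ζ • B u := by rw [← hBA, hAu, map_smul]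
    have h8 : A (B u) = A (A (A (A (A (A (A (A (B u)))))))) := by
      have := LinearMap.congr_fun h7 (A (B u))
      simpa [pow_succ] using this.symm
    rw [h8]
    simp only [h2, map_smul, smul_smul]
    congr 1
    ring
  have hBu := step hAu
  have hBBu := step hBu
  have hB0 {u : V} (hu : u ≠ 0) : B u ≠ 0 := fun h ↦ hu (hB (by rw [h, map_zero]))
  have hprim : IsPrimitiveRoot ζ 7 := by
    have : Fact (Nat.Prime 7) := ⟨by norm_num⟩
    have := IsPrimitiveRoot.orderOf ζ
    rwa [orderOf_eq_prime hζ7 hζ1] at this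
  have hinj : Function.Injective fun i : Fin 4 ↦ ζ ^ (![0, 1, 4, 2] i : ℕ) := by
    intro i j h
    have := hprim.pow_inj (by fin_cases i <;> simp) (by fin_cases j <;> simp) h
    revert this
    fin_cases i <;> fin_cases j <;> simp
  have hli := Module.End.eigenvectors_linearIndependent' A _ hinj ![v, u, B u, B (B u)] (by
    intro i
    rw [Module.End.hasEigenvector_iff, Module.End.mem_eigenspace_iff]
    fin_cases i
    · simpa using ⟨by simpa using hAv, hv⟩
    · simpa using ⟨hAu, hu⟩
    · simpa using ⟨hBu, hB0 hu⟩
    · refine ⟨?_, hB0 (hB0 hu)⟩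
      change A (B (B u)) = ζ ^ 2 • B (B u)
      rw [hBBu]
      congr 1
      calc (ζ ^ 4) ^ 4 = (ζ ^ 7) ^ 2 * ζ ^ 2 := by ring
        _ = ζ ^ 2 := by rw [hζ7, one_pow, one_mul])
  have := hli.fintype_card_le_finrank
  rw [hV, Fintype.card_fin] at this
  omega

lemma adjugate_fin_three_eq (A : Matrix (Fin 3) (Fin 3) ℂ) :
    A.adjugate = A * A - A.trace • A + A.adjugate.trace • 1 := by
  rw [Matrix.adjugate_fin_three]
  ext i j
  fin_cases i <;> fin_cases j <;>
    simp [Matrix.trace_fin_three, Matrix.mul_apply, Fin.sum_univ_three] <;> ring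

lemma trace_eq_neg_one_of_involution {A : Matrix (Fin 3) (Fin 3) ℂ} (h2 : A * A = 1)
    (h1 : A ≠ 1) (hdet : A.det = 1) : A.trace = -1 := by
  have hadj : A.adjugate = A := by
    have h := A.mul_adjugate
    rw [hdet, one_smul] at h
    calc A.adjugate = A * A * A.adjugate := by rw [h2, one_mul]
      _ = A := by rw [mul_assoc, h, mul_one]
  have h := adjugate_fin_three_eq A
  rw [hadj, h2] at h
  have h3 : (1 + A.trace) • (A - 1) = 0 := by
    rw [add_smul, one_smul]
    nth_rw 1 [h]
    module
  rcases smul_eq_zero.1 h3 with h4 | h4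
  · linear_combination h4
  · exact absurd (sub_eq_zero.1 h4) h1

/-- Two commuting involutions of determinant 1 generating a Klein four-group in dimension 3 have
no common fixed vector. -/
lemma eq_zero_of_klein_four {A B : Matrix (Fin 3) (Fin 3) ℂ} (hA : A * A = 1) (hB : B * B = 1)
    (hAB : A * B = B * A) (hA1 : A ≠ 1) (hB1 : B ≠ 1) (hAB1 : A * B ≠ 1) (hdA : A.det = 1)
    (hdB : B.det = 1) {v : Fin 3 → ℂ} (hAv : A *ᵥ v = v) (hBv : B *ᵥ v = v) : v = 0 := by
  have tA := trace_eq_neg_one_of_involution hA hA1 hdA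
  have tB := trace_eq_neg_one_of_involution hB hB1 hdB
  have tAB := trace_eq_neg_one_of_involution
    (by rw [mul_assoc, ← mul_assoc B, ← hAB, mul_assoc, hB, mul_one, hA]) hAB1
    (by rw [Matrix.det_mul, hdA, hdB, one_mul])
  set e : Matrix (Fin 3) (Fin 3) ℂ := (1 / 4 : ℂ) • (1 + A + B + A * B) with he
  have hAe : A * e = e := by
    rw [he, mul_smul_comm]
    congr 1
    simp only [mul_add, ← mul_assoc, hA, mul_one, one_mul]
    abel
  have hBe : B * e = e := by
    rw [he, mul_smul_comm]
    congr 1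
    simp only [mul_add, mul_one, hB, hAB, ← mul_assoc, one_mul]
    abel
  have hidem : IsIdempotentElem e := by
    change e * e = e
    nth_rw 1 [he]
    simp only [smul_mul_assoc, add_mul, mul_assoc, hAe, hBe, one_mul]
    module
  have htr : e.trace = 0 := by
    simp [he, tA, tB, tAB]
    norm_num
  have he0 : e = 0 := by
    have h : IsIdempotentElem (Matrix.toLin' e) := by
      rw [IsIdempotentElem, Module.End.mul_eq_comp, ← Matrix.toLin'_mul, hidem]
    simpa using LinearMap.IsIdempotentElem.eq_zero_of_trace_eq_zero h
      (by rw [Matrix.trace_toLin'_eq, htr])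
  have hev : e *ᵥ v = v := by
    simp only [he, Matrix.smul_mulVec, Matrix.add_mulVec, ← Matrix.mulVec_mulVec, hAv, hBv,
      Matrix.one_mulVec]
    module
  rw [← hev, he0, Matrix.zero_mulVec]

end LinearAlgebra

namespace SL27

variable {r : SL27 →* GL3}

/-- If the commutator `x` of `S` and `h` generates together with its conjugate by `S` a quaternion
group, then `S` and `h` have no common eigenvector. -/
lemma not_common_eigenvector_of_quaternion (hneg : r (-1) = 1)
    (hker : ∀ g, r g = 1 → g = 1 ∨ g = -1) {h x y : SL27} (hx : x * (h * S) = S * h)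
    (hy : y * S = S * x) (hxx : x * x = -1) (hyy : y * y = -1) (hxy : x * y = -1 * (y * x))
    {v : Fin 3 → ℂ} (hv : v ≠ 0) {a b : ℂ} (hSv : (r S : M3) *ᵥ v = a • v)
    (hhv : (r h : M3) *ᵥ v = b • v) : False := by
  have mul (g k : SL27) : (r (g * k) : M3) = (r g : M3) * (r k : M3) := by simp
  have hne {g : SL27} {c : ℂ} (hg : (r g : M3) *ᵥ v = c • v) : c ≠ 0 := by
    rintro rfl
    apply hv
    calc v = (r (g⁻¹ * g) : M3) *ᵥ v := by simp
      _ = 0 := by rw [mul, ← Matrix.mulVec_mulVec, hg, zero_smul, Matrix.mulVec_zero]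
  have hdet (g : SL27) : (r g : M3).det ≠ 0 :=
    ((Matrix.isUnit_iff_isUnit_det _).1 (r g).isUnit).ne_zero
  have ha := hne hSv
  have hb := hne hhv
  have hneg' : (r (-1) : M3) = 1 := by rw [hneg, Units.val_one]
  have hone {g : SL27} (hg : g * g = -1) : (r g : M3) ≠ 1 := by
    intro h1
    rcases hker g (Units.ext h1) with rfl | rfl <;> revert hg <;> decide
  have hdx : (r x : M3).det = 1 := by
    have := congrArg (fun g ↦ (r g : M3).det) hx
    simp only [mul, Matrix.det_mul] at this
    refine mul_right_cancel₀ (mul_ne_zero (hdet h) (hdet S)) ?_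
    rw [this]
    ring
  have hdy : (r y : M3).det = 1 := by
    have := congrArg (fun g ↦ (r g : M3).det) hy
    simp only [mul, Matrix.det_mul, hdx] at this
    refine mul_right_cancel₀ (hdet S) ?_
    rw [this]
    ring
  have hxv : (r x : M3) *ᵥ v = v := by
    have := congrArg (fun g ↦ (r g : M3) *ᵥ v) hx
    simp only [mul, ← Matrix.mulVec_mulVec, hSv, hhv, Matrix.mulVec_smul, smul_smul] at this
    rw [mul_comm a b] at this
    exact smul_right_injective _ (mul_ne_zero hb ha) this
  have hyv : (r y : M3) *ᵥ v = v := by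
    have := congrArg (fun g ↦ (r g : M3) *ᵥ v) hy
    simp only [mul, ← Matrix.mulVec_mulVec, hSv, hxv, Matrix.mulVec_smul] at this
    exact smul_right_injective _ ha this
  refine hv (eq_zero_of_klein_four (A := r x) (B := r y) (by rw [← mul, hxx, hneg'])
    (by rw [← mul, hyy, hneg']) (by rw [← mul, hxy, mul, hneg', one_mul, mul]) (hone hxx)
    (hone hyy) (by
      rw [← mul]
      refine hone ?_
      calc x * y * (x * y) = x * (y * x) * y := by simp only [mul_assoc]
        _ = x * (-1 * (x * y)) * y := by rw [hxy]; simp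
        _ = -((x * x) * (y * y)) := by simp [mul_assoc]
        _ = -1 := by rw [hxx, hyy]; simp) hdx hdy hxv hyv)

end SL27

lemma PSL27.mk_eq_one {g : SL27} (hg : (QuotientGroup.mk g : PSL27) = 1) : g = 1 ∨ g = -1 := by
  rw [QuotientGroup.eq_one_iff, Matrix.SpecialLinearGroup.mem_center_iff] at hg
  obtain ⟨c, hc, hcg⟩ := hg
  have : c = 1 ∨ c = -1 := by
    rw [Fintype.card_fin] at hc
    clear hcg
    revert c
    decide
  rcases this with rfl | rfl
  · exact Or.inl (Subtype.ext (by rw [← hcg]; simp))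
  · exact Or.inr (Subtype.ext (by rw [← hcg, map_neg, map_one]; rfl))

lemma PSL27.mk_neg_one : (QuotientGroup.mk (-1 : SL27) : PSL27) = 1 := by
  rw [QuotientGroup.eq_one_iff, Matrix.SpecialLinearGroup.mem_center_iff]
  exact ⟨-1, by simp, by rw [map_neg, map_one]; rfl⟩

lemma SL27.eight_lt_encard_projOrbit (r : SL27 →* GL3) (hneg : r (-1) = 1)
    (hker : ∀ g, r g = 1 → g = 1 ∨ g = -1) (p : P2) :
    8 < (projOrbit (matSetGL r.range) p).encard := by
  let : MulAction SL27 P2 :=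
    MulAction.compHom P2
      ((Matrix.GeneralLinearGroup.toLin (n := Fin 3) (R := ℂ)).toMonoidHom.comp r)
  have hsmul (g : SL27) (q : P2) :
      ∃ h : (r g : M3) *ᵥ q.rep ≠ 0, Projectivization.mk ℂ ((r g : M3) *ᵥ q.rep) h = g • q := by
    have h : g • q = Matrix.GeneralLinearGroup.toLin (r g) •
        Projectivization.mk ℂ q.rep q.rep_nonzero := by
      rw [q.mk_rep]
      rfl
    rw [Projectivization.smul_mk] at h
    exact ⟨_, h.symm⟩
  have hfix {g : SL27} {q : P2} (h : g • q = q) : ∃ c : ℂ, (r g : M3) *ᵥ q.rep = c • q.rep := by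
    obtain ⟨h0, h1⟩ := hsmul g q
    rw [h] at h1
    nth_rw 2 [← q.mk_rep] at h1
    obtain ⟨c, hc⟩ := (Projectivization.mk_eq_mk_iff' ℂ _ _ _ _).1 h1
    exact ⟨c, hc.symm⟩
  have horbit : projOrbit (matSetGL r.range) p = MulAction.orbit SL27 p := by
    ext q
    constructor
    · rintro ⟨_, ⟨_, ⟨g, rfl⟩, rfl⟩, h, rfl⟩
      obtain ⟨h0, h1⟩ := hsmul g p
      exact ⟨g, h1.symm⟩
    · rintro ⟨g, rfl⟩
      exact ⟨_, ⟨_, ⟨g, rfl⟩, rfl⟩, hsmul g p⟩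
  rw [horbit]
  refine eight_lt_encard_orbit ?_ ?_ ?_ p
  · intro q hT hS
    obtain ⟨a, ha⟩ := hfix hT
    obtain ⟨b, hb⟩ := hfix hS
    refine not_common_eigenvector_of_mul_eq_sq_mul (V := Fin 3 → ℂ) (by simp)
      (A := Matrix.toLin' (r T : M3)) (B := Matrix.toLin' (r S : M3)) ?_ ?_ ?_ ?_
      q.rep_nonzero ha hb
    · rw [← Matrix.toLin'_pow, ← Units.val_pow_eq_pow_val, ← map_pow, T_pow_seven, map_one,
        Units.val_one, Matrix.toLin'_one]
      rfl
    · intro h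
      have h1 : (r T : M3) = 1 := Matrix.toLin'.injective (h.trans Matrix.toLin'_one.symm)
      rcases hker T (Units.ext h1) with h | h <;> revert h <;> decide
    · exact Matrix.mulVec_injective_of_isUnit (r S).isUnit
    · rw [← Matrix.toLin'_pow, Module.End.mul_eq_comp, Module.End.mul_eq_comp,
        ← Matrix.toLin'_mul, ← Matrix.toLin'_mul, ← Units.val_pow_eq_pow_val, ← map_pow,
        ← Units.val_mul, ← Units.val_mul, ← map_mul, ← map_mul, S_mul_T]
  · intro q hS hh
    obtain ⟨a, ha⟩ := hfix hS
    obtain ⟨b, hb⟩ := hfix hh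
    exact not_common_eigenvector_of_quaternion hneg hker (x := ⟨!![4, 1; 4, 3], by decide⟩)
      (y := ⟨!![4, 2; 2, 3], by decide⟩) (by decide) (by decide) (by decide) (by decide)
      (by decide) q.rep_nonzero ha hb
  · intro q hS hh
    obtain ⟨a, ha⟩ := hfix hS
    obtain ⟨b, hb⟩ := hfix hh
    exact not_common_eigenvector_of_quaternion hneg hker (x := ⟨!![4, 6; 3, 3], by decide⟩)
      (y := ⟨!![4, 5; 5, 3], by decide⟩) (by decide) (by decide) (by decide) (by decide)
      (by decide) q.rep_nonzero ha hb

/-- if `ρ : PSL(2,𝔽₇) → GL(3,ℂ)` is an injective group homomorphism, then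
every orbit of `ρ(PSL(2,𝔽₇))` on `ℙ²` has more than 8 elements. -/
theorem statement16 (ρ : PSL27 →* GL3) (hρ : Function.Injective ρ) :
    ∀ p : P2, 8 < (projOrbit (matSetGL ρ.range) p).encard := by
  intro p
  set r : SL27 →* GL3 := ρ.comp (QuotientGroup.mk' _) with hr
  have hrange : r.range = ρ.range := by
    rw [hr, MonoidHom.range_comp, QuotientGroup.range_mk', ← MonoidHom.range_eq_map]
  rw [← hrange]
  refine SL27.eight_lt_encard_projOrbit r ?_ (fun g hg ↦ ?_) p
  · change ρ (QuotientGroup.mk (-1 : SL27)) = 1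
    rw [PSL27.mk_neg_one, map_one]
  · exact PSL27.mk_eq_one (hρ (by rw [map_one]; exact hg))
end
end

section
/- Let G ≤ GL(3,ℂ) be a finite subgroup such that the quotient of G by its subgroup of scalar matrices (G ∩ {λ·I₃ : λ ∈ ℂ}) is isomorphic to the alternating group A₆ on 6 letters. Then every G-orbit on ℙ² has more than 8 elements. -/
open Matrix Complex

noncomputable section

lemma exists_nat_trace_of_isIdempotentElem {P : M3} (hP : P * P = P) :
    ∃ m : ℕ, P.trace = m ∧ (m = 0 → P = 0) := by
  have h : IsIdempotentElem (Matrix.toLin' P) := by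
    rw [IsIdempotentElem, Module.End.mul_eq_comp, ← Matrix.toLin'_mul, hP]
  have ht : LinearMap.trace ℂ (Fin 3 → ℂ) (Matrix.toLin' P) = P.trace :=
    Matrix.trace_toLin'_eq P
  refine ⟨Module.finrank ℂ (LinearMap.range (Matrix.toLin' P)), ?_, fun h0 => ?_⟩
  · rw [← ht, (LinearMap.IsIdempotentElem.isProj_range _ h).trace]
  · have hz : LinearMap.trace ℂ (Fin 3 → ℂ) (Matrix.toLin' P) = 0 := by
      rw [(LinearMap.IsIdempotentElem.isProj_range _ h).trace, h0, Nat.cast_zero]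
    exact Matrix.toLin'.map_eq_zero_iff.mp (LinearMap.IsIdempotentElem.trace_eq_zero_iff h |>.mp hz)

/-- In dimension three, commuting involutions `V`, `W` such that some `T` conjugates `V` to `W`
and `W` to `V * W` have no common nonzero fixed vector unless `V = 1`. -/
lemma eq_one_of_tetrahedral_relations {V W T T' : M3} {x : Fin 3 → ℂ} (hx : x ≠ 0)
    (hV : V * V = 1) (hW : W * W = 1) (hVW : V * W = W * V) (hT : T * T' = 1)
    (hTV : T * V = W * T) (hTW : T * W = V * W * T)
    (hVx : V *ᵥ x = x) (hWx : W *ᵥ x = x) : V = 1 := by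
  have conj_trace {A B : M3} (h : T * A = B * T) : B.trace = A.trace := by
    calc B.trace = (B * T * T').trace := by rw [Matrix.mul_assoc, hT, Matrix.mul_one]
      _ = (T' * T * A).trace := by
        rw [← h, Matrix.trace_mul_comm, Matrix.mul_assoc]
      _ = A.trace := by rw [mul_eq_one_comm.mp hT, Matrix.one_mul]
  have htW := conj_trace hTV
  have htVW := (conj_trace hTW).trans htW
  have hWV : W * V = V * W := hVW.symm
  have hVVW : V * (V * W) = W := by rw [← Matrix.mul_assoc, hV, Matrix.one_mul]
  have hWVW : W * (V * W) = V := by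
    rw [← Matrix.mul_assoc, hWV, Matrix.mul_assoc, hW, Matrix.mul_one]
  obtain ⟨m, hm, -⟩ := exists_nat_trace_of_isIdempotentElem
    (P := (1 / 2 : ℂ) • (1 + V)) (by
      simp only [Matrix.smul_mul, Matrix.mul_smul, Matrix.add_mul, Matrix.mul_add,
        Matrix.one_mul, Matrix.mul_one, hV]
      module)
  obtain ⟨n, hn, hn0⟩ := exists_nat_trace_of_isIdempotentElem
    (P := (1 / 2 : ℂ) • (1 - V)) (by
      simp only [Matrix.smul_mul, Matrix.mul_smul, Matrix.sub_mul, Matrix.mul_sub,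
        Matrix.one_mul, Matrix.mul_one, hV]
      module)
  obtain ⟨r, hr, hr0⟩ := exists_nat_trace_of_isIdempotentElem
    (P := (1 / 4 : ℂ) • (1 + V + W + V * W)) (by
      simp only [Matrix.smul_mul, Matrix.mul_smul, Matrix.add_mul, Matrix.mul_add,
        Matrix.one_mul, Matrix.mul_one, Matrix.mul_assoc, hV, hW, hWV, hVVW, hWVW]
      module)
  simp only [Matrix.trace_smul, Matrix.trace_add, Matrix.trace_sub, Matrix.trace_one,
    Fintype.card_fin, htW, htVW, smul_eq_mul] at hm hn hr
  have h1 : m + n = 3 := by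
    have : (m : ℂ) + n = 3 := by rw [← hm, ← hn]; push_cast; ring
    exact_mod_cast this
  have h2 : 2 * r + 3 = 3 * m := by
    have : (2 : ℂ) * r + 3 = 3 * m := by rw [← hm, ← hr]; push_cast; ring
    exact_mod_cast this
  by_cases hn' : n = 0
  · have h := hn0 hn'
    rw [smul_eq_zero_iff_right (by norm_num), sub_eq_zero] at h
    exact h.symm
  · exfalso
    have h := hr0 (by omega)
    rw [smul_eq_zero_iff_right (by norm_num)] at h
    have h4 : (1 + V + W + V * W) *ᵥ x = (4 : ℂ) • x := by
      rw [Matrix.add_mulVec, Matrix.add_mulVec, Matrix.add_mulVec, ← Matrix.mulVec_mulVec, hWx,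
        hVx, Matrix.one_mulVec]
      module
    rw [h, Matrix.zero_mulVec] at h4
    exact hx ((smul_eq_zero_iff_right (by norm_num)).mp h4.symm)

lemma Equiv.Perm.card_ne_forty_five (K : Subgroup (Equiv.Perm (Fin 6))) : Nat.card K ≠ 45 := by
  intro hK
  have : Fact (Nat.Prime 5) := ⟨by norm_num⟩
  obtain ⟨h, hh⟩ := exists_prime_orderOf_dvd_card' (G := K) 5 (by rw [hK]; norm_num)
  have h1 : h ≠ 1 := by
    rintro rfl
    simp at hh
  obtain ⟨x, hx⟩ : ∃ x, h • x ≠ x := by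
    by_contra! hall
    exact h1 (Subtype.ext (Equiv.ext hall))
  have hZ : (MulAction.orbit (Subgroup.zpowers h) x).ncard = 5 := by
    have hd := (MulAction.stabilizer (Subgroup.zpowers h) x).index_dvd_card
    rw [MulAction.index_stabilizer, Nat.card_zpowers, hh] at hd
    refine ((Nat.dvd_prime (by norm_num)).mp hd).resolve_left fun h1' => ?_
    obtain ⟨a, ha⟩ := Set.ncard_eq_one.mp h1'
    have hxa : x ∈ MulAction.orbit (Subgroup.zpowers h) x := MulAction.mem_orbit_self x
    have hhxa : h • x ∈ MulAction.orbit (Subgroup.zpowers h) x :=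
      ⟨⟨h, Subgroup.mem_zpowers h⟩, rfl⟩
    rw [ha] at hxa hhxa
    exact hx (hhxa.trans hxa.symm)
  have hsub : MulAction.orbit (Subgroup.zpowers h) x ⊆ MulAction.orbit K x := by
    rintro _ ⟨g, rfl⟩
    exact ⟨g.1, rfl⟩
  have hle := Set.ncard_le_ncard hsub (Set.toFinite _)
  have hKd := (MulAction.stabilizer K x).index_dvd_card
  rw [MulAction.index_stabilizer, hK] at hKd
  have hadd := Set.ncard_add_ncard_compl (MulAction.orbit K x)
  rw [Nat.card_eq_fintype_card, Fintype.card_fin] at hadd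
  have ho : (MulAction.orbit K x)ᶜ.ncard = 1 := by
    have h6 : (MulAction.orbit K x).ncard ≤ 6 := by omega
    have h5 : 5 ≤ (MulAction.orbit K x).ncard := by omega
    generalize (MulAction.orbit K x).ncard = o at *
    interval_cases o
    · omega
    · norm_num at hKd
  obtain ⟨y, hy⟩ := Set.ncard_eq_one.mp ho
  have hfix : K ≤ MulAction.stabilizer (Equiv.Perm (Fin 6)) y := by
    intro k hk
    have hyc : y ∈ (MulAction.orbit K x)ᶜ := by rw [hy]; rfl
    have : (⟨k, hk⟩ : K) • y ∈ (MulAction.orbit K x)ᶜ := by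
      intro hm
      rw [← MulAction.orbit_eq_iff, MulAction.orbit_smul] at hm
      exact hyc (MulAction.orbit_eq_iff.mp hm)
    rw [hy] at this
    exact this
  have hd := Subgroup.card_dvd_of_le hfix
  have hi := (MulAction.stabilizer (Equiv.Perm (Fin 6)) y).card_mul_index
  rw [MulAction.index_stabilizer_of_transitive, Nat.card_perm] at hi
  simp only [Nat.card_eq_fintype_card, Fintype.card_fin] at hi hd hK
  rw [hK] at hd
  have : Nat.factorial 6 = 720 := rfl
  omega

lemma exists_tetrahedral_of_range_eq {A : Type*} [Group A] (F : A →* Equiv.Perm (Fin 6))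
    (hF : Function.Injective F) (hr : F.range = alternatingGroup (Fin 6)) :
    ∃ v w t : A, v ≠ 1 ∧ v * v = 1 ∧ w * w = 1 ∧ v * w = w * v ∧ t * v = w * t ∧
      t * w = v * w * t ∧ F v 0 = 0 ∧ F w 0 = 0 ∧ F t 0 = 0 := by
  have lift (s : Equiv.Perm (Fin 6)) (hs : Equiv.Perm.sign s = 1) : ∃ a, F a = s := by
    rw [← MonoidHom.mem_range, hr]
    exact hs
  obtain ⟨v, hv⟩ := lift (Equiv.swap 1 2 * Equiv.swap 3 4) (by decide)
  obtain ⟨w, hw⟩ := lift (Equiv.swap 1 3 * Equiv.swap 2 4) (by decide)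
  obtain ⟨t, ht⟩ := lift (Equiv.swap 2 3 * Equiv.swap 3 4) (by decide)
  refine ⟨v, w, t, ?_, ?_, ?_, ?_, ?_, ?_, ?_, ?_, ?_⟩
  · rintro rfl
    rw [map_one] at hv
    revert hv
    decide
  all_goals try apply hF
  all_goals simp only [map_mul, map_one, hv, hw, ht]
  all_goals decide

lemma exists_tetrahedral_of_index_le (H : Subgroup (alternatingGroup (Fin 6)))
    (hH : H.index ≤ 8) :
    ∃ v ∈ H, ∃ w ∈ H, ∃ t ∈ H, v ≠ 1 ∧ v * v = 1 ∧ w * w = 1 ∧ v * w = w * v ∧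
      t * v = w * t ∧ t * w = v * w * t := by
  have hcard : Nat.card (alternatingGroup (Fin 6)) = 360 := by
    rw [nat_card_alternatingGroup, Nat.card_eq_fintype_card, Fintype.card_fin]
    rfl
  have : IsSimpleGroup (alternatingGroup (Fin 6)) := alternatingGroup.isSimpleGroup (by simp)
  have hker := H.normalCore_eq_ker
  rcases H.normalCore_normal.eq_bot_or_eq_top with hb | ht
  swap
  · obtain ⟨v, w, t, h⟩ := exists_tetrahedral_of_range_eq (alternatingGroup (Fin 6)).subtype
      Subtype.val_injective (Subgroup.range_subtype _)
    have hmem (a) : a ∈ H := H.normalCore_le (ht ▸ Subgroup.mem_top a)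
    exact ⟨v, hmem v, w, hmem w, t, hmem t, h.1, h.2.1, h.2.2.1, h.2.2.2.1, h.2.2.2.2.1,
      h.2.2.2.2.2.1⟩
  rw [hb, eq_comm, MonoidHom.ker_eq_bot_iff] at hker
  have hmul := H.card_mul_index
  rw [hcard] at hmul
  have hi0 : H.index ≠ 0 := Subgroup.index_ne_zero_of_finite
  have hdvd := Subgroup.card_dvd_of_injective _ hker
  rw [hcard, Nat.card_perm, ← Subgroup.index] at hdvd
  have h6 : H.index = 6 := by
    have h45 : Nat.card H ≠ 45 := by
      have := Equiv.Perm.card_ne_forty_five (H.map (alternatingGroup (Fin 6)).subtype)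
      rwa [Subgroup.card_map_of_injective Subtype.val_injective] at this
    generalize H.index = i at *
    interval_cases i
    all_goals first | (norm_num [Nat.factorial] at hdvd; done) | omega
  classical
  let e₀ : (alternatingGroup (Fin 6) ⧸ H) ≃ Fin 6 :=
    Finite.equivFinOfCardEq h6
  let e := e₀.trans (Equiv.swap (e₀ (1 : alternatingGroup (Fin 6))) 0)
  have he : e (1 : alternatingGroup (Fin 6)) = 0 := by simp [e]
  let F : alternatingGroup (Fin 6) →* Equiv.Perm (Fin 6) :=
    e.permCongrHom.toMonoidHom.comp
      (MulAction.toPermHom (alternatingGroup (Fin 6)) (alternatingGroup (Fin 6) ⧸ H))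
  have hF : Function.Injective F := e.permCongrHom.injective.comp hker
  have hFmem {a} (ha : F a 0 = 0) : a ∈ H := by
    have h1 : F a 0 = e (a • e.symm 0) := rfl
    have h2 : e.symm 0 = (1 : alternatingGroup (Fin 6)) := by rw [← he, Equiv.symm_apply_apply]
    rw [h1, h2, ← he, e.apply_eq_iff_eq, MulAction.Quotient.smul_coe, smul_eq_mul, mul_one,
      eq_comm, QuotientGroup.eq] at ha
    simpa using ha
  have hr : F.range = alternatingGroup (Fin 6) := by
    apply Equiv.Perm.eq_alternatingGroup_of_index_eq_two
    have h := F.range.card_mul_index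
    rw [Nat.card_perm, Nat.card_eq_fintype_card (α := Fin 6), Fintype.card_fin,
      ← Nat.card_congr (MonoidHom.ofInjective hF).toEquiv, hcard] at h
    have : Nat.factorial 6 = 720 := rfl
    omega
  obtain ⟨v, w, t, h1, h2, h3, h4, h5, h6, hv, hw, ht⟩ := exists_tetrahedral_of_range_eq F hF hr
  exact ⟨v, hFmem hv, w, hFmem hw, t, hFmem ht, h1, h2, h3, h4, h5, h6⟩

/-- The elements of `G` having `x` as an eigenvector. -/
def lineStabilizer (G : Subgroup GL3) (x : Fin 3 → ℂ) : Subgroup G where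
  carrier := {g | ∃ c : ℂˣ, ((g : GL3) : M3) *ᵥ x = c • x}
  one_mem' := ⟨1, by simp⟩
  mul_mem' := by
    rintro g h ⟨a, ha⟩ ⟨b, hb⟩
    refine ⟨b * a, ?_⟩
    rw [Subgroup.coe_mul, Units.val_mul, ← Matrix.mulVec_mulVec, hb, Matrix.mulVec_smul, ha,
      smul_smul]
  inv_mem' := by
    rintro g ⟨a, ha⟩
    refine ⟨a⁻¹, ?_⟩
    have h : (((g⁻¹ : G) : GL3) : M3) *ᵥ (((g : GL3) : M3) *ᵥ x) = x := by
      rw [Matrix.mulVec_mulVec, ← Units.val_mul, ← Subgroup.coe_mul, inv_mul_cancel]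
      simp
    rw [ha, Matrix.mulVec_smul] at h
    rw [← h, smul_smul, inv_mul_cancel, one_smul, h]

lemma index_lineStabilizer_le (G : Subgroup GL3) (p : P2)
    (hp : (projOrbit (matSetGL G) p).Finite) :
    (lineStabilizer G p.rep).index ≤ (projOrbit (matSetGL G) p).ncard := by
  have hne (g : G) : ((g : GL3) : M3) *ᵥ p.rep ≠ 0 := by
    intro h
    apply p.rep_nonzero
    have := congrArg (fun y => (((g⁻¹ : G) : GL3) : M3) *ᵥ y) h
    simpa [Matrix.mulVec_mulVec, ← Units.val_mul, ← Subgroup.coe_mul] using this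
  let f (g : G) : projOrbit (matSetGL G) p :=
    ⟨Projectivization.mk ℂ _ (hne g), _, ⟨g, g.2, rfl⟩, hne g, rfl⟩
  have hf (g h : G) : f g = f h → g⁻¹ * h ∈ lineStabilizer G p.rep := by
    intro hgh
    obtain ⟨a, ha⟩ := (Projectivization.mk_eq_mk_iff ℂ _ _ (hne g) (hne h)).mp
      (congrArg Subtype.val hgh)
    refine ⟨a⁻¹, ?_⟩
    rw [Subgroup.coe_mul, Units.val_mul, ← Matrix.mulVec_mulVec, eq_inv_smul_iff,
      ← Matrix.mulVec_smul, ha, Matrix.mulVec_mulVec, ← Units.val_mul, ← Subgroup.coe_mul]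
    simp
  have := hp.to_subtype
  rw [Subgroup.index, ← Nat.card_coe_set_eq]
  refine Nat.card_le_card_of_injective (fun q : G ⧸ lineStabilizer G p.rep => f q.out) ?_
  intro q r hqr
  rw [← q.out_eq', ← r.out_eq']
  exact QuotientGroup.eq.mpr (hf _ _ hqr)

/-- if `G ≤ GL(3,ℂ)` is a finite subgroup whose quotient by its subgroup of
scalar matrices is isomorphic to the alternating group `A₆` (expressed by a surjective
homomorphism `φ : G → A₆` whose kernel consists exactly of the scalar matrices in `G`),
then every `G`-orbit on `ℙ²` has more than 8 elements. -/
theorem statement17 (G : Subgroup GL3) (hfin : Finite G)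
    (hquot : ∃ φ : G →* ↥(alternatingGroup (Fin 6)), Function.Surjective φ ∧
      ∀ g : G, φ g = 1 ↔ ∃ c : ℂ, ((g : GL3) : M3) = c • (1 : M3)) :
    ∀ p : P2, 8 < (projOrbit (matSetGL G) p).encard := by
  intro p
  obtain ⟨φ, hsurj, hscalar⟩ := hquot
  by_contra! hle
  have hx := p.rep_nonzero
  set x := p.rep
  have hO : (projOrbit (matSetGL G) p).Finite :=
    Set.finite_of_encard_le_coe (k := 8) hle
  have hO8 : (projOrbit (matSetGL G) p).ncard ≤ 8 := by
    rw [← hO.cast_ncard_eq] at hle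
    exact_mod_cast hle
  have hker : φ.ker ≤ lineStabilizer G x := by
    intro g hg
    obtain ⟨c, hc⟩ := (hscalar g).mp hg
    have hc0 : c ≠ 0 := by
      rintro rfl
      rw [zero_smul] at hc
      exact (g : GL3).ne_zero hc
    exact ⟨Units.mk0 c hc0, by rw [hc, Matrix.smul_mulVec, Matrix.one_mulVec]; rfl⟩
  have hindex : ((lineStabilizer G x).map φ).index ≤ 8 := by
    rw [Subgroup.index_map_eq _ hsurj hker]
    exact (index_lineStabilizer_le G p hO).trans hO8
  have key {g h : G} {a b : ℂˣ} (hgh : φ g = φ h) (hg : ((g : GL3) : M3) *ᵥ x = a • x)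
      (hh : ((h : GL3) : M3) *ᵥ x = b • x) :
      a⁻¹ • ((g : GL3) : M3) = b⁻¹ • ((h : GL3) : M3) := by
    obtain ⟨c, hc⟩ := (hscalar (g⁻¹ * h)).mp (by rw [map_mul, map_inv, hgh, inv_mul_cancel])
    have hcg : ((h : GL3) : M3) = c • ((g : GL3) : M3) := by
      have : h = g * (g⁻¹ * h) := by group
      rw [this, Subgroup.coe_mul, Units.val_mul, hc, Matrix.mul_smul, Matrix.mul_one]
    have hbc : (b : ℂ) = c * a := by
      rw [hcg, Matrix.smul_mulVec, hg, Units.smul_def, Units.smul_def, smul_smul] at hh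
      exact (smul_left_injective ℂ hx hh).symm
    rw [eq_inv_smul_iff, smul_comm, inv_smul_eq_iff, Units.smul_def, Units.smul_def, hbc, hcg,
      smul_smul, mul_comm]
  obtain ⟨_, ⟨v, ⟨a, ha⟩, rfl⟩, _, ⟨w, ⟨b, hb⟩, rfl⟩, _, ⟨t, ⟨d, hd⟩, rfl⟩, hv1, hvv, hww, hvw,
    htv, htw⟩ := exists_tetrahedral_of_index_le _ hindex
  have mul_eig {g h : G} {a b : ℂˣ} (hg : ((g : GL3) : M3) *ᵥ x = a • x)
      (hh : ((h : GL3) : M3) *ᵥ x = b • x) : (((g * h : G) : GL3) : M3) *ᵥ x = (a * b) • x := by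
    rw [Subgroup.coe_mul, Units.val_mul, ← Matrix.mulVec_mulVec, hh, Matrix.mulVec_smul, hg,
      smul_smul, mul_comm]
  have one_eig : (((1 : G) : GL3) : M3) *ᵥ x = (1 : ℂˣ) • x := by simp
  have norm_mul (g h : G) (a b : ℂˣ) : (a * b)⁻¹ • (((g * h : G) : GL3) : M3) =
      (a⁻¹ • ((g : GL3) : M3)) * (b⁻¹ • ((h : GL3) : M3)) := by
    rw [Subgroup.coe_mul, Units.val_mul, smul_mul_smul_comm, mul_inv]
  have norm_one : (1 : ℂˣ)⁻¹ • (((1 : G) : GL3) : M3) = 1 := by simp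
  simp only [← map_mul] at hvv hww hvw htv htw
  have hV := key (hvv.trans (map_one φ).symm) (mul_eig ha ha) one_eig
  have hW := key (hww.trans (map_one φ).symm) (mul_eig hb hb) one_eig
  have hVW := key hvw (mul_eig ha hb) (mul_eig hb ha)
  have hTV := key htv (mul_eig hd ha) (mul_eig hb hd)
  have hTW := key htw (mul_eig hd hb) (mul_eig (mul_eig ha hb) hd)
  simp only [norm_mul, norm_one] at hV hW hVW hTV hTW
  have hT : (d⁻¹ • ((t : GL3) : M3)) * (d⁻¹⁻¹ • (((t⁻¹ : G) : GL3) : M3)) = 1 := by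
    rw [← norm_mul, mul_inv_cancel, mul_inv_cancel, norm_one]
  have hV1 := eq_one_of_tetrahedral_relations hx hV hW hVW hT hTV hTW
    (by rw [Matrix.smul_mulVec, ha, inv_smul_smul]) (by rw [Matrix.smul_mulVec, hb, inv_smul_smul])
  refine hv1 ((hscalar v).mpr ⟨a, ?_⟩)
  rwa [inv_smul_eq_iff, Units.smul_def] at hV1
end
end
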